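/- arXiv:2005.04778 — 6 statements merged into one kernel-verified Lean document; each statement's English description precedes it below -/
import Mathlib

section
/- Every quasi-category admits a (strongly unital) nonassociative Frobenius structure. -/
open CategoryTheory Simplicial SSet

namespace NaF

/-- Cast of simplices along an equality of dimensions. -/
def cX (X : SSet) {m n : ℕ} (h : m = n) (x : X _⦋m⦌) : X _⦋n⦌ :=
  _root_.cast (congrArg (fun k => X _⦋k⦌) h) x

/-- The first vertex of a `p`-simplex. -/
def firstVertex {X : SSet} {p : ℕ} (x : X _⦋p⦌) : X _⦋0⦌ :=
  X.map (SimplexCategory.const ⦋0⦌ ⦋p⦌ 0).op x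

/-- The last vertex of a `p`-simplex. -/
def lastVertex {X : SSet} {p : ℕ} (x : X _⦋p⦌) : X _⦋0⦌ :=
  X.map (SimplexCategory.const ⦋0⦌ ⦋p⦌ (Fin.last p)).op x

/-- The inclusion `[k] → [n]` onto the first `k+1` vertices; its action on a simplicial
set is the composite of the face maps `d_{k+1} ∘ ⋯ ∘ d_n` (applied starting with the
highest index). -/
def initSeg (k n : ℕ) (h : k ≤ n) : (⦋k⦌ : SimplexCategory) ⟶ ⦋n⦌ :=
  SimplexCategory.mkHom ⟨fun i => ⟨i.val, by omega⟩, fun i j hij => by simpa using hij⟩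

/-- The inclusion `[k] → [n]` onto the last `k+1` vertices; its action on a simplicial
set is the composite of face maps `(d_0)^{n-k}`. -/
def lastSeg (k n : ℕ) (h : k ≤ n) : (⦋k⦌ : SimplexCategory) ⟶ ⦋n⦌ :=
  SimplexCategory.mkHom ⟨fun i => ⟨i.val + (n - k), by omega⟩, fun i j hij => by
    simp only [Fin.mk_le_mk]
    exact Nat.add_le_add_right hij _⟩

/-- A (strongly unital) nonassociative Frobenius structure on a simplicial set `X`:
a family of operations `Z^{p,q} : X_p × X_q → X_{p+q}`, defined (at least) on all pairs
`(x, y)` for which the last vertex of `x` agrees with the first vertex of `y`,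
satisfying unitality, naturality with respect to inner faces and all degeneracies,
and the Frobenius compatibility conditions with outer face composites. -/
structure Struct (X : SSet) where
  Z : ∀ p q : ℕ, X _⦋p⦌ → X _⦋q⦌ → X _⦋p + q⦌
  unit_right : ∀ (p : ℕ) (x : X _⦋p⦌) (y : X _⦋0⦌),
    lastVertex x = firstVertex y → Z p 0 x y = x
  unit_left : ∀ (q : ℕ) (x : X _⦋0⦌) (y : X _⦋q⦌),
    lastVertex x = firstVertex y → Z 0 q x y = cX X (Nat.zero_add q).symm y
  d_inner_left : ∀ (p q : ℕ) (x : X _⦋p + 1⦌) (y : X _⦋q⦌),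
    lastVertex x = firstVertex y → ∀ i : Fin (p + 2), 0 < i.val → i.val < p + 1 →
      X.δ (⟨i.val, by omega⟩ : Fin (p + q + 2)) (cX X (by omega) (Z (p + 1) q x y)) =
        Z p q (X.δ i x) y
  d_inner_right : ∀ (p q : ℕ) (x : X _⦋p⦌) (y : X _⦋q + 1⦌),
    lastVertex x = firstVertex y → ∀ j : Fin (q + 2), 0 < j.val → j.val < q + 1 →
      X.δ (⟨p + j.val, by omega⟩ : Fin (p + q + 2)) (Z p (q + 1) x y) =
        Z p q x (X.δ j y)
  s_left : ∀ (p q : ℕ) (x : X _⦋p⦌) (y : X _⦋q⦌),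
    lastVertex x = firstVertex y → ∀ i : Fin (p + 1),
      X.σ (⟨i.val, by omega⟩ : Fin (p + q + 1)) (Z p q x y) =
        cX X (by omega) (Z (p + 1) q (X.σ i x) y)
  s_right : ∀ (p q : ℕ) (x : X _⦋p⦌) (y : X _⦋q⦌),
    lastVertex x = firstVertex y → ∀ j : Fin (q + 1),
      X.σ (⟨p + j.val, by omega⟩ : Fin (p + q + 1)) (Z p q x y) =
        Z p (q + 1) x (X.σ j y)
  frob_init_left : ∀ (k r q : ℕ) (x : X _⦋k + r⦌) (y : X _⦋q⦌),
    lastVertex x = firstVertex y →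
      X.map (initSeg k (k + r + q) (by omega)).op (Z (k + r) q x y) =
        X.map (initSeg k (k + r) (by omega)).op x
  frob_last_left : ∀ (k r q : ℕ) (x : X _⦋k + r⦌) (y : X _⦋q⦌),
    lastVertex x = firstVertex y →
      X.map (lastSeg (r + q) (k + r + q) (by omega)).op (Z (k + r) q x y) =
        Z r q (X.map (lastSeg r (k + r) (by omega)).op x) y
  frob_init_right : ∀ (p j t : ℕ) (x : X _⦋p⦌) (y : X _⦋j + t⦌),
    lastVertex x = firstVertex y →
      X.map (initSeg (p + j) (p + (j + t)) (by omega)).op (Z p (j + t) x y) =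
        Z p j x (X.map (initSeg j (j + t) (by omega)).op y)
  frob_last_right : ∀ (p j t : ℕ) (x : X _⦋p⦌) (y : X _⦋j + t⦌),
    lastVertex x = firstVertex y →
      X.map (lastSeg t (p + (j + t)) (by omega)).op (Z p (j + t) x y) =
        X.map (lastSeg t (j + t) (by omega)).op y

end NaF

namespace NaF

open CategoryTheory.Limits

universe u

/-- The value of a morphism of `SimplexCategory` as a natural number. -/
def vl {m n : ℕ} (f : (⦋m⦌ : SimplexCategory) ⟶ ⦋n⦌) (i : Fin (m + 1)) : ℕ :=
  (f.toOrderHom i).val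

lemma vl_lt {m n : ℕ} (f : (⦋m⦌ : SimplexCategory) ⟶ ⦋n⦌) (i : Fin (m + 1)) :
    vl f i < n + 1 := (f.toOrderHom i).isLt

lemma vl_mono {m n : ℕ} (f : (⦋m⦌ : SimplexCategory) ⟶ ⦋n⦌) {i j : Fin (m + 1)}
    (h : i.val ≤ j.val) : vl f i ≤ vl f j := f.toOrderHom.monotone h

lemma vl_ext {m n : ℕ} {f g : (⦋m⦌ : SimplexCategory) ⟶ ⦋n⦌} (h : ∀ i, vl f i = vl g i) :
    f = g := by
  apply SimplexCategory.Hom.ext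
  apply OrderHom.ext
  funext i
  exact Fin.ext (h i)

lemma vl_comp {m n k : ℕ} (f : (⦋m⦌ : SimplexCategory) ⟶ ⦋n⦌)
    (g : (⦋n⦌ : SimplexCategory) ⟶ ⦋k⦌) (i : Fin (m + 1)) :
    vl (f ≫ g) i = vl g ⟨vl f i, vl_lt f i⟩ := rfl

lemma vl_id {m : ℕ} (i : Fin (m + 1)) : vl (𝟙 (⦋m⦌ : SimplexCategory)) i = i.val := rfl

lemma vl_δ {m : ℕ} (j : Fin (m + 2)) (i : Fin (m + 1)) :
    vl (SimplexCategory.δ j) i = if i.val < j.val then i.val else i.val + 1 := by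
  have : vl (SimplexCategory.δ j) i = (j.succAbove i).val := rfl
  rw [this, Fin.succAbove]
  simp only [Fin.lt_def, Fin.val_castSucc]
  split_ifs <;> simp

lemma vl_σ {m : ℕ} (j : Fin (m + 1)) (i : Fin (m + 2)) :
    vl (SimplexCategory.σ j) i = if i.val ≤ j.val then i.val else i.val - 1 := by
  have : vl (SimplexCategory.σ j) i = (j.predAbove i).val := rfl
  rw [this, Fin.predAbove]
  simp only [Fin.lt_def, Fin.val_castSucc]
  split_ifs <;> simp <;> omega

lemma vl_initSeg (k n : ℕ) (h : k ≤ n) (i : Fin (k + 1)) : vl (initSeg k n h) i = i.val := rfl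

lemma vl_lastSeg (k n : ℕ) (h : k ≤ n) (i : Fin (k + 1)) :
    vl (lastSeg k n h) i = i.val + (n - k) := rfl

lemma vl_const (m n : ℕ) (j : Fin (n + 1)) (i : Fin (m + 1)) :
    vl (SimplexCategory.const ⦋m⦌ ⦋n⦌ j) i = j.val := rfl

/-- Cast morphism. -/
def ca {m n : ℕ} (h : m = n) : (⦋m⦌ : SimplexCategory) ⟶ ⦋n⦌ :=
  SimplexCategory.mkHom ⟨fun i => ⟨i.val, by omega⟩, fun i j hij => by simpa using hij⟩

lemma vl_ca {m n : ℕ} (h : m = n) (i : Fin (m + 1)) : vl (ca h) i = i.val := rfl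

/-- The wedge of two morphisms. -/
def wedge {p' p q' q : ℕ} (α : (⦋p'⦌ : SimplexCategory) ⟶ ⦋p⦌)
    (β : (⦋q'⦌ : SimplexCategory) ⟶ ⦋q⦌) :
    (⦋p' + q'⦌ : SimplexCategory) ⟶ ⦋p + q⦌ :=
  SimplexCategory.mkHom
    ⟨fun i => if h : i.val ≤ p' then ⟨vl α ⟨i.val, by omega⟩, by
        have := vl_lt α ⟨i.val, by omega⟩; omega⟩
      else ⟨p + vl β ⟨i.val - p', by omega⟩, by
        have := vl_lt β ⟨i.val - p', by omega⟩; omega⟩, fun i j hij => by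
      have hij' : i.val ≤ j.val := hij
      by_cases hi : i.val ≤ p'
      · by_cases hj : j.val ≤ p'
        · simp only [hi, hj, dite_true, Fin.mk_le_mk]
          exact vl_mono α hij'
        · simp only [hi, hj, dite_true, dite_false, Fin.mk_le_mk]
          have := vl_lt α ⟨i.val, by omega⟩
          omega
      · have hj : ¬ j.val ≤ p' := by omega
        simp only [hi, hj, dite_false, Fin.mk_le_mk]
        have := vl_mono β (i := ⟨i.val - p', by omega⟩) (j := ⟨j.val - p', by omega⟩)
          (Nat.sub_le_sub_right hij' _)
        omega⟩

lemma vl_wedge {p' p q' q : ℕ} (α : (⦋p'⦌ : SimplexCategory) ⟶ ⦋p⦌)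
    (β : (⦋q'⦌ : SimplexCategory) ⟶ ⦋q⦌) (i : Fin (p' + q' + 1)) :
    vl (wedge α β) i = if h : i.val ≤ p' then vl α ⟨i.val, by omega⟩
      else p + vl β ⟨i.val - p', by omega⟩ := by
  have : vl (wedge α β) i = (if h : i.val ≤ p' then (⟨vl α ⟨i.val, by omega⟩, by
        have := vl_lt α ⟨i.val, by omega⟩; omega⟩ : Fin (p + q + 1))
      else ⟨p + vl β ⟨i.val - p', by omega⟩, by
        have := vl_lt β ⟨i.val - p', by omega⟩; omega⟩).val := rfl
  rw [this]
  split_ifs <;> rfl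

/-- Last-vertex-preserving. -/
def LP {m n : ℕ} (f : (⦋m⦌ : SimplexCategory) ⟶ ⦋n⦌) : Prop := vl f (Fin.last m) = n

/-- First-vertex-preserving. -/
def FP {m n : ℕ} (f : (⦋m⦌ : SimplexCategory) ⟶ ⦋n⦌) : Prop := vl f 0 = 0

lemma LP_id (m : ℕ) : LP (𝟙 (⦋m⦌ : SimplexCategory)) := rfl
lemma FP_id (m : ℕ) : FP (𝟙 (⦋m⦌ : SimplexCategory)) := rfl

lemma LP_comp {m n k : ℕ} {f : (⦋m⦌ : SimplexCategory) ⟶ ⦋n⦌}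
    {g : (⦋n⦌ : SimplexCategory) ⟶ ⦋k⦌} (hf : LP f) (hg : LP g) : LP (f ≫ g) := by
  unfold LP at *
  rw [vl_comp]
  simp only [hf]
  exact hg

lemma FP_comp {m n k : ℕ} {f : (⦋m⦌ : SimplexCategory) ⟶ ⦋n⦌}
    {g : (⦋n⦌ : SimplexCategory) ⟶ ⦋k⦌} (hf : FP f) (hg : FP g) : FP (f ≫ g) := by
  unfold FP at *
  rw [vl_comp]
  simp only [hf]
  exact hg

lemma LP_right {m n k : ℕ} {f : (⦋m⦌ : SimplexCategory) ⟶ ⦋n⦌}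
    {g : (⦋n⦌ : SimplexCategory) ⟶ ⦋k⦌} (h : LP (f ≫ g)) : LP g := by
  unfold LP at *
  rw [vl_comp] at h
  have h1 := vl_mono g (i := ⟨vl f (Fin.last m), vl_lt f _⟩) (j := Fin.last n)
    (by have := vl_lt f (Fin.last m); simp only [Fin.val_last]; omega)
  have h2 := vl_lt g (Fin.last n)
  omega

lemma FP_right {m n k : ℕ} {f : (⦋m⦌ : SimplexCategory) ⟶ ⦋n⦌}
    {g : (⦋n⦌ : SimplexCategory) ⟶ ⦋k⦌} (h : FP (f ≫ g)) : FP g := by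
  unfold FP at *
  rw [vl_comp] at h
  have h1 := vl_mono g (i := 0) (j := ⟨vl f 0, vl_lt f _⟩) (by simp)
  omega

lemma LP_of_epi {m n : ℕ} (f : (⦋m⦌ : SimplexCategory) ⟶ ⦋n⦌) [Epi f] : LP f := by
  obtain ⟨i, hi⟩ := (SimplexCategory.epi_iff_surjective.1 ‹Epi f›) (Fin.last n)
  have h0 : vl f i = n := congrArg Fin.val hi
  have h1 := vl_mono f (i := i) (j := Fin.last m) (by simp only [Fin.val_last]; omega)
  have h2 := vl_lt f (Fin.last m)
  unfold LP
  omega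

lemma FP_of_epi {m n : ℕ} (f : (⦋m⦌ : SimplexCategory) ⟶ ⦋n⦌) [Epi f] : FP f := by
  obtain ⟨i, hi⟩ := (SimplexCategory.epi_iff_surjective.1 ‹Epi f›) (0 : Fin (n + 1))
  have h0 : vl f i = 0 := congrArg Fin.val hi
  have h1 := vl_mono f (i := 0) (j := i) (by simp)
  unfold FP
  omega

lemma wedge_id (p q : ℕ) : wedge (𝟙 (⦋p⦌ : SimplexCategory)) (𝟙 (⦋q⦌ : SimplexCategory)) = 𝟙 _ := by
  apply vl_ext
  intro i
  rw [vl_wedge]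
  simp only [vl_id]
  split_ifs <;> omega

lemma wedge_comp {p p' p'' q q' q'' : ℕ}
    (s : (⦋p''⦌ : SimplexCategory) ⟶ ⦋p'⦌) (t : (⦋q''⦌ : SimplexCategory) ⟶ ⦋q'⦌)
    {α : (⦋p'⦌ : SimplexCategory) ⟶ ⦋p⦌} {β : (⦋q'⦌ : SimplexCategory) ⟶ ⦋q⦌}
    (hα : LP α) (hβ : FP β) :
    wedge s t ≫ wedge α β = wedge (s ≫ α) (t ≫ β) := by
  apply vl_ext
  intro i
  rw [vl_comp]
  by_cases h : i.val ≤ p''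
  · have h1 := vl_lt s ⟨i.val, by omega⟩
    have h2 : vl s ⟨i.val, by omega⟩ ≤ p' := by omega
    simp only [vl_wedge, h, dite_true, h2, vl_comp]
  · simp only [vl_wedge, h, dite_false, vl_comp]
    split_ifs with h3
    · have h4 : vl t ⟨i.val - p'', by omega⟩ = 0 := by omega
      simp only [h4]
      have e1 : vl α ⟨p' + 0, by omega⟩ = p := hα
      have e2 : vl β ⟨0, by omega⟩ = 0 := hβ
      rw [e1, e2, Nat.add_zero]
    · simp only [Nat.add_sub_cancel_left]

variable {X : SSet.{u}}

lemma mm {a b c : ℕ} (f : (⦋a⦌ : SimplexCategory) ⟶ ⦋b⦌) (g : (⦋b⦌ : SimplexCategory) ⟶ ⦋c⦌)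
    (x : X _⦋c⦌) : X.map f.op (X.map g.op x) = X.map (f ≫ g).op x := by
  simp

lemma mid {a : ℕ} (x : X _⦋a⦌) : X.map (𝟙 (⦋a⦌ : SimplexCategory)).op x = x := by
  simp

lemma cX_eq {m n : ℕ} (h : m = n) (x : X _⦋m⦌) : cX X h x = X.map (ca h.symm).op x := by
  subst h
  have : ca (rfl : m = m) = 𝟙 _ := vl_ext fun i => rfl
  rw [this, mid]
  rfl

/-- Composability. -/
def Cmp {p q : ℕ} (x : X _⦋p⦌) (y : X _⦋q⦌) : Prop := lastVertex x = firstVertex y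

lemma lastVertex_map {m n : ℕ} {f : (⦋m⦌ : SimplexCategory) ⟶ ⦋n⦌} (hf : LP f) (x : X _⦋n⦌) :
    lastVertex (X.map f.op x) = lastVertex x := by
  unfold lastVertex
  rw [mm]
  have : SimplexCategory.const ⦋0⦌ ⦋m⦌ (Fin.last m) ≫ f =
      SimplexCategory.const ⦋0⦌ ⦋n⦌ (Fin.last n) := vl_ext fun i => hf
  rw [this]

lemma firstVertex_map {m n : ℕ} {f : (⦋m⦌ : SimplexCategory) ⟶ ⦋n⦌} (hf : FP f) (x : X _⦋n⦌) :
    firstVertex (X.map f.op x) = firstVertex x := by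
  unfold firstVertex
  rw [mm]
  have : SimplexCategory.const ⦋0⦌ ⦋m⦌ 0 ≫ f =
      SimplexCategory.const ⦋0⦌ ⦋n⦌ 0 := vl_ext fun i => hf
  rw [this]

lemma Cmp.map {p q p' q' : ℕ} {x : X _⦋p⦌} {y : X _⦋q⦌} (h : Cmp x y)
    {α : (⦋p'⦌ : SimplexCategory) ⟶ ⦋p⦌} {β : (⦋q'⦌ : SimplexCategory) ⟶ ⦋q⦌}
    (hα : LP α) (hβ : FP β) : Cmp (X.map α.op x) (X.map β.op y) := by
  unfold Cmp
  rw [lastVertex_map hα, firstVertex_map hβ]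
  exact h

lemma Cmp.of_map {p q p' q' : ℕ} {x : X _⦋p⦌} {y : X _⦋q⦌}
    {α : (⦋p'⦌ : SimplexCategory) ⟶ ⦋p⦌} {β : (⦋q'⦌ : SimplexCategory) ⟶ ⦋q⦌}
    (hα : LP α) (hβ : FP β) (h : Cmp (X.map α.op x) (X.map β.op y)) : Cmp x y := by
  unfold Cmp at h
  rwa [lastVertex_map hα, firstVertex_map hβ] at h

lemma cmp_zero {x y : X _⦋0⦌} (h : Cmp x y) : x = y := by
  have h1 : SimplexCategory.const ⦋0⦌ ⦋0⦌ (Fin.last 0) = 𝟙 _ := vl_ext fun i => by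
    rw [vl_const, vl_id]; have := i.isLt; simp only [Fin.val_last]; omega
  have h2 : SimplexCategory.const ⦋0⦌ ⦋0⦌ 0 = 𝟙 _ := vl_ext fun i => by
    rw [vl_const, vl_id]; have := i.isLt; simp only [Fin.val_zero]; omega
  unfold Cmp lastVertex firstVertex at h
  rwa [h1, h2, mid, mid] at h

lemma factor {a b : ℕ} (f : (⦋a⦌ : SimplexCategory) ⟶ ⦋b⦌) :
    ∃ (c : ℕ) (e : (⦋a⦌ : SimplexCategory) ⟶ ⦋c⦌) (m : (⦋c⦌ : SimplexCategory) ⟶ ⦋b⦌),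
      Epi e ∧ Mono m ∧ e ≫ m = f :=
  ⟨(image f).len, factorThruImage f, image.ι f, inferInstanceAs (Epi (factorThruImage f)),
    inferInstanceAs (Mono (image.ι f)), image.fac f⟩

lemma horn_fill [Quasicategory X] (n : ℕ) (i : Fin (n + 3)) (h0 : 0 < i)
    (hn : i < Fin.last (n + 2)) (F : ∀ j : Fin (n + 3), j ≠ i → X _⦋n + 1⦌)
    (hF : ∀ (j k : Fin (n + 3)) (hj : j ≠ i) (hk : k ≠ i) (hjk : j < k),
      X.map (SimplexCategory.δ (k.pred (Fin.ne_zero_of_lt hjk))).op (F j hj) =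
      X.map (SimplexCategory.δ (j.castPred (Fin.ne_last_of_lt hjk))).op (F k hk)) :
    ∃ z : X _⦋n + 2⦌, ∀ j hj, X.map (SimplexCategory.δ j).op z = F j hj := by
  have hc : horn.IsCompatible (i := i) (fun j hj => yonedaEquiv.symm (F j hj)) := by
    rw [horn.isCompatible_iff]
    intro j k hj hk hjk
    rw [stdSimplex.δ_comp_yonedaEquiv_symm, stdSimplex.δ_comp_yonedaEquiv_symm]
    exact congrArg _ (hF j k hj hk hjk)
  obtain ⟨φ, hφ⟩ := hc.exists_desc
  obtain ⟨σ, hσ⟩ := Quasicategory.hornFilling h0 hn φ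
  refine ⟨SSet.yonedaEquiv σ, fun j hj => ?_⟩
  have h1 := hφ j hj
  rw [hσ, ← Category.assoc, horn.ι_ι] at h1
  have h2 := congrArg SSet.yonedaEquiv h1
  rw [Equiv.apply_symm_apply] at h2
  rw [← h2]
  exact SSet.yonedaEquiv_naturality _ _

/-- Partial structure in total dimension `< n`. -/
structure Good (X : SSet.{u}) (n : ℕ) (Z : ∀ p q : ℕ, X _⦋p⦌ → X _⦋q⦌ → X _⦋p + q⦌) : Prop where
  unitR : ∀ (p : ℕ) (x : X _⦋p⦌) (y : X _⦋0⦌), p < n → Cmp x y → Z p 0 x y = x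
  unitL : ∀ (q : ℕ) (x : X _⦋0⦌) (y : X _⦋q⦌), q < n → Cmp x y →
    Z 0 q x y = cX X (Nat.zero_add q).symm y
  nat : ∀ (p q p' q' : ℕ) (α : (⦋p'⦌ : SimplexCategory) ⟶ ⦋p⦌)
    (β : (⦋q'⦌ : SimplexCategory) ⟶ ⦋q⦌) (x : X _⦋p⦌) (y : X _⦋q⦌),
    LP α → FP β → p + q < n → p' + q' < n → Cmp x y →
    X.map (wedge α β).op (Z p q x y) = Z p' q' (X.map α.op x) (X.map β.op y)

variable {Z : ∀ p q : ℕ, X _⦋p⦌ → X _⦋q⦌ → X _⦋p + q⦌} {n : ℕ}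

lemma Good.compat (hZ : Good X n Z) {p q p₁ q₁ p₂ q₂ r w a : ℕ} {x : X _⦋p⦌} {y : X _⦋q⦌}
    (hxy : Cmp x y)
    {α₁ : (⦋p₁⦌ : SimplexCategory) ⟶ ⦋p⦌} {β₁ : (⦋q₁⦌ : SimplexCategory) ⟶ ⦋q⦌}
    {α₂ : (⦋p₂⦌ : SimplexCategory) ⟶ ⦋p⦌} {β₂ : (⦋q₂⦌ : SimplexCategory) ⟶ ⦋q⦌}
    (s₁ : (⦋r⦌ : SimplexCategory) ⟶ ⦋p₁⦌) (t₁ : (⦋w⦌ : SimplexCategory) ⟶ ⦋q₁⦌)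
    (s₂ : (⦋r⦌ : SimplexCategory) ⟶ ⦋p₂⦌) (t₂ : (⦋w⦌ : SimplexCategory) ⟶ ⦋q₂⦌)
    {γ₁ : (⦋a⦌ : SimplexCategory) ⟶ ⦋p₁ + q₁⦌} {γ₂ : (⦋a⦌ : SimplexCategory) ⟶ ⦋p₂ + q₂⦌}
    (γ : (⦋a⦌ : SimplexCategory) ⟶ ⦋r + w⦌)
    (hα₁ : LP α₁) (hα₂ : LP α₂) (hβ₁ : FP β₁) (hβ₂ : FP β₂)
    (hs₁ : LP s₁) (hs₂ : LP s₂) (ht₁ : FP t₁) (ht₂ : FP t₂)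
    (hs : s₁ ≫ α₁ = s₂ ≫ α₂) (ht : t₁ ≫ β₁ = t₂ ≫ β₂)
    (h₁ : γ₁ = γ ≫ wedge s₁ t₁) (h₂ : γ₂ = γ ≫ wedge s₂ t₂)
    (hd₁ : p₁ + q₁ < n) (hd₂ : p₂ + q₂ < n) (hd : r + w < n) :
    X.map γ₁.op (Z p₁ q₁ (X.map α₁.op x) (X.map β₁.op y)) =
      X.map γ₂.op (Z p₂ q₂ (X.map α₂.op x) (X.map β₂.op y)) := by
  rw [h₁, h₂, ← mm, ← mm, hZ.nat _ _ _ _ _ _ _ _ hs₁ ht₁ hd₁ hd (hxy.map hα₁ hβ₁),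
    hZ.nat _ _ _ _ _ _ _ _ hs₂ ht₂ hd₂ hd (hxy.map hα₂ hβ₂), mm, mm, mm, mm, hs, ht]

lemma key1 (a b P : ℕ) (h : b ≤ P + 1) : (if a < b then a else a + 1) =
    if _ : a ≤ P then (if a < b then a else a + 1) else P + 1 + (a - P) := by
  split_ifs <;> omega

lemma key2 (a b P : ℕ) (h : P < b) : (if a < b then a else a + 1) =
    if _ : a ≤ P then a else P + (if a - P < b - P then a - P else a - P + 1) := by
  split_ifs <;> omega

lemma LP_δ {m : ℕ} (j : Fin (m + 2)) (h : j.val < m + 1) : LP (SimplexCategory.δ j) := by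
  unfold LP
  rw [vl_δ]
  simp only [Fin.val_last]
  (repeat' split) <;> omega

lemma FP_δ {m : ℕ} (j : Fin (m + 2)) (h : 0 < j.val) : FP (SimplexCategory.δ j) := by
  unfold FP
  rw [vl_δ]
  exact if_pos h

lemma fill [Quasicategory X] (P Q : ℕ) (hZ : Good X (P + 1 + (Q + 1)) Z)
    (x : X _⦋P + 1⦌) (y : X _⦋Q + 1⦌) (hxy : Cmp x y) :
    ∃ z : X _⦋P + 1 + (Q + 1)⦌,
      (∀ j : Fin (P + 2), j.val < P + 1 →
        X.map (wedge (SimplexCategory.δ j) (𝟙 ⦋Q + 1⦌)).op z =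
          Z P (Q + 1) (X.map (SimplexCategory.δ j).op x) (X.map (𝟙 ⦋Q + 1⦌ : ⦋Q + 1⦌ ⟶ _).op y)) ∧
      (∀ j : Fin (Q + 2), 0 < j.val →
        X.map (wedge (𝟙 ⦋P + 1⦌) (SimplexCategory.δ j)).op z =
          Z (P + 1) Q (X.map (𝟙 ⦋P + 1⦌ : ⦋P + 1⦌ ⟶ _).op x) (X.map (SimplexCategory.δ j).op y)) := by
  let F : ∀ j : Fin (P + Q + 3), X _⦋P + Q + 1⦌ := fun j =>
    if h : j.val < P + 1 then
      X.map (ca (by omega : P + Q + 1 = P + (Q + 1))).op (Z P (Q + 1)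
        (X.map (SimplexCategory.δ (⟨j.val, by omega⟩ : Fin (P + 2))).op x)
        (X.map (𝟙 ⦋Q + 1⦌ : ⦋Q + 1⦌ ⟶ _).op y))
    else X.map (ca (by omega : P + Q + 1 = P + 1 + Q)).op (Z (P + 1) Q
        (X.map (𝟙 ⦋P + 1⦌ : ⦋P + 1⦌ ⟶ _).op x)
        (X.map (SimplexCategory.δ (⟨j.val - (P + 1), by omega⟩ : Fin (Q + 2))).op y))
  have hFl : ∀ (j : Fin (P + Q + 3)) (h : j.val < P + 1), F j =
      X.map (ca (by omega : P + Q + 1 = P + (Q + 1))).op (Z P (Q + 1)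
        (X.map (SimplexCategory.δ (⟨j.val, by omega⟩ : Fin (P + 2))).op x)
        (X.map (𝟙 ⦋Q + 1⦌ : ⦋Q + 1⦌ ⟶ _).op y)) := fun j h => dif_pos h
  have hFr : ∀ (j : Fin (P + Q + 3)) (h : ¬ j.val < P + 1), F j =
      X.map (ca (by omega : P + Q + 1 = P + 1 + Q)).op (Z (P + 1) Q
        (X.map (𝟙 ⦋P + 1⦌ : ⦋P + 1⦌ ⟶ _).op x)
        (X.map (SimplexCategory.δ (⟨j.val - (P + 1), by omega⟩ : Fin (Q + 2))).op y)) :=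
    fun j h => dif_neg h
  obtain ⟨z, hz⟩ := horn_fill (X := X) (P + Q) ⟨P + 1, by omega⟩
    (by simp [Fin.lt_def]) (by simp [Fin.lt_def]) (fun j _ => F j) (by
      intro j k hj hk hjk
      have hjk' : j.val < k.val := hjk
      have hj' : j.val ≠ P + 1 := fun h => hj (Fin.ext h)
      have hk' : k.val ≠ P + 1 := fun h => hk (Fin.ext h)
      dsimp only
      by_cases h1 : j.val < P + 1
      · by_cases h2 : k.val < P + 1
        · rw [hFl j h1, hFl k h2, mm, mm]
          obtain ⟨P', rfl⟩ : ∃ P', P = P' + 1 := ⟨P - 1, by omega⟩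
          refine hZ.compat hxy (SimplexCategory.δ ⟨k.val - 1, by omega⟩) (𝟙 _)
            (SimplexCategory.δ ⟨j.val, by omega⟩) (𝟙 _) (ca (by omega))
            (LP_δ _ h1) (LP_δ _ h2) (FP_id _) (FP_id _)
            (LP_δ _ (by dsimp only; omega)) (LP_δ _ (by dsimp only; omega))
            (FP_id _) (FP_id _) ?_ rfl ?_ ?_ (by omega) (by omega) (by omega)
          all_goals
            apply vl_ext
            intro i
            have := i.isLt
            simp only [vl_comp, vl_δ, vl_wedge, vl_ca, vl_id, Fin.val_pred, Fin.coe_castPred]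
            first | (split_ifs <;> omega) | exact key1 _ _ _ (by omega)
        · rw [hFl j h1, hFr k h2, mm, mm]
          refine hZ.compat hxy (𝟙 _) (SimplexCategory.δ ⟨k.val - (P + 1), by omega⟩)
            (SimplexCategory.δ ⟨j.val, by omega⟩) (𝟙 _) (ca (by omega))
            (LP_δ _ h1) (LP_id _) (FP_id _) (FP_δ _ (by dsimp only; omega))
            (LP_id _) (LP_δ _ (by dsimp only; omega))
            (FP_δ _ (by dsimp only; omega)) (FP_id _) rfl rfl ?_ ?_ (by omega) (by omega) (by omega)
          all_goals
            apply vl_ext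
            intro i
            have := i.isLt
            simp only [vl_comp, vl_δ, vl_wedge, vl_ca, vl_id, Fin.val_pred, Fin.coe_castPred]
            first | (split_ifs <;> omega) | exact key1 _ _ _ (by omega)
      · have h2 : ¬ k.val < P + 1 := by omega
        rw [hFr j h1, hFr k h2, mm, mm]
        obtain ⟨Q', rfl⟩ : ∃ Q', Q = Q' + 1 := ⟨Q - 1, by omega⟩
        refine hZ.compat hxy (𝟙 _) (SimplexCategory.δ ⟨k.val - (P + 1) - 1, by omega⟩)
          (𝟙 _) (SimplexCategory.δ ⟨j.val - (P + 1), by omega⟩) (ca (by omega))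
          (LP_id _) (LP_id _) (FP_δ _ (by dsimp only; omega)) (FP_δ _ (by dsimp only; omega))
          (LP_id _) (LP_id _) (FP_δ _ (by dsimp only; omega)) (FP_δ _ (by dsimp only; omega))
          rfl ?_ ?_ ?_ (by omega) (by omega) (by omega)
        all_goals
          apply vl_ext
          intro i
          have := i.isLt
          simp only [vl_comp, vl_δ, vl_wedge, vl_ca, vl_id, Fin.val_pred, Fin.coe_castPred]
          first | (split_ifs <;> omega) | exact key2 _ _ _ (by omega))
  refine ⟨X.map (ca (by omega : P + 1 + (Q + 1) = P + Q + 2)).op z, fun j hj => ?_, fun j hj => ?_⟩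
  · have h1 := hz ⟨j.val, by omega⟩ (fun h => by have := congrArg Fin.val h; dsimp only at this; omega)
    rw [hFl _ hj] at h1
    have h2 := congrArg (X.map (ca (by omega : P + (Q + 1) = P + Q + 1)).op) h1
    rw [mm, mm] at h2
    have e : ca (by omega : P + (Q + 1) = P + Q + 1) ≫ ca (by omega : P + Q + 1 = P + (Q + 1)) =
      𝟙 _ := vl_ext fun i => rfl
    rw [e, mid] at h2
    rw [← h2, mm]
    refine congrArg (fun f => X.map (Quiver.Hom.op f) z) (vl_ext fun i => ?_)
    have := i.isLt
    simp only [vl_comp, vl_δ, vl_wedge, vl_ca, vl_id]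
    split_ifs <;> omega
  · have h1 := hz ⟨P + 1 + j.val, by omega⟩
      (fun h => by have := congrArg Fin.val h; dsimp only at this; omega)
    rw [hFr _ (by dsimp only; omega)] at h1
    have h2 := congrArg (X.map (ca (by omega : P + 1 + Q = P + Q + 1)).op) h1
    rw [mm, mm] at h2
    have e : ca (by omega : P + 1 + Q = P + Q + 1) ≫ ca (by omega : P + Q + 1 = P + 1 + Q) =
      𝟙 _ := vl_ext fun i => rfl
    rw [e, mid] at h2
    simp only [Nat.add_sub_cancel_left] at h2
    rw [← h2, mm]
    refine congrArg (fun f => X.map (Quiver.Hom.op f) z) (vl_ext fun i => ?_)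
    have := i.isLt
    simp only [vl_comp, vl_δ, vl_wedge, vl_ca, vl_id]
    split_ifs <;> omega

/-- The condition on a candidate value of `Z` in total dimension `n`. -/
structure PP (X : SSet.{u}) (n : ℕ) (Z : ∀ p q : ℕ, X _⦋p⦌ → X _⦋q⦌ → X _⦋p + q⦌)
    (p q : ℕ) (x : X _⦋p⦌) (y : X _⦋q⦌) (z : X _⦋p + q⦌) : Prop where
  r : ∀ h : q = 0, z = cX X (by omega) x
  l : ∀ h : p = 0, z = cX X (by omega) y
  face : ∀ (p' q' : ℕ) (α : (⦋p'⦌ : SimplexCategory) ⟶ ⦋p⦌)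
    (β : (⦋q'⦌ : SimplexCategory) ⟶ ⦋q⦌), LP α → FP β → Mono α → Mono β → p' + q' < n →
    X.map (wedge α β).op z = Z p' q' (X.map α.op x) (X.map β.op y)
  deg : ∀ (p' q' : ℕ) (α : (⦋p⦌ : SimplexCategory) ⟶ ⦋p'⦌)
    (β : (⦋q⦌ : SimplexCategory) ⟶ ⦋q'⦌) (x' : X _⦋p'⦌) (y' : X _⦋q'⦌),
    Epi α → Epi β → p' + q' < n →
    x = X.map α.op x' → y = X.map β.op y' → z = X.map (wedge α β).op (Z p' q' x' y')

lemma hom_zero_eq (f : (⦋0⦌ : SimplexCategory) ⟶ ⦋0⦌) : f = 𝟙 _ := vl_ext fun i => by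
  have h1 := vl_lt f i
  have h2 := i.isLt
  rw [vl_id]
  omega

/-- Eilenberg-Zilber: any presentation of `x` by an epi factors through the nondegenerate one. -/
lemma ez {p p₀ p' : ℕ} {x : X _⦋p⦌} (f : (⦋p⦌ : SimplexCategory) ⟶ ⦋p₀⦌) (hf : Epi f)
    (x₀ : X.nonDegenerate p₀) (hx : x = X.map f.op x₀.1)
    (α : (⦋p⦌ : SimplexCategory) ⟶ ⦋p'⦌) (hα : Epi α) (x' : X _⦋p'⦌) (hx' : x = X.map α.op x') :
    ∃ g : (⦋p'⦌ : SimplexCategory) ⟶ ⦋p₀⦌, Epi g ∧ x' = X.map g.op x₀.1 ∧ f = α ≫ g := by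
  obtain ⟨m, g, hg, w, hw⟩ := X.exists_nonDegenerate x'
  have h1 : x = X.map (α ≫ g).op w.1 := by rw [hx', hw, mm]
  have hag : Epi (α ≫ g) := epi_comp _ _
  obtain rfl := X.unique_nonDegenerate_dim x f x₀ hx (α ≫ g) w h1
  obtain rfl := X.unique_nonDegenerate_simplex x f x₀ hx (α ≫ g) w h1
  exact ⟨g, hg, hw, X.unique_nonDegenerate_map x f x₀ hx (α ≫ g) x₀ h1⟩

lemma cmp_zero' {q : ℕ} (h : q = 0) {x : X _⦋0⦌} {y : X _⦋q⦌} (h1 : q = 0 + q) (h2 : 0 = 0 + q)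
    (hxy : Cmp x y) : cX X h1 y = cX X h2 x := by
  subst h
  rw [cmp_zero hxy]

lemma exists_step [Quasicategory X] (hZ : Good X n Z) (p q : ℕ) (hn : p + q = n)
    (x : X _⦋p⦌) (y : X _⦋q⦌) (hxy : Cmp x y) : ∃ z, PP X n Z p q x y z := by
  obtain _ | P := p
  · refine ⟨cX X (by omega) y, ?_, fun _ => rfl, ?_, ?_⟩
    · exact fun h => cmp_zero' h _ _ hxy
    · intro p' q' α β hα hβ hmα hmβ hlt
      obtain rfl : p' = 0 := by have := SimplexCategory.le_of_mono α; omega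
      obtain rfl := hom_zero_eq α
      rw [hZ.unitL _ _ _ (by omega) (hxy.map hα hβ), cX_eq, cX_eq, mm, mm]
      refine congrArg (fun f => X.map (Quiver.Hom.op f) y) (vl_ext fun i => ?_)
      simp only [vl_comp, vl_wedge, vl_ca, vl_id]
      split_ifs with h
      · have : i = 0 := Fin.ext (by simpa using h)
        subst this
        exact hβ.symm
      · simp only [Nat.zero_add, Nat.sub_zero]
    · intro p' q' α β x' y' hα hβ hlt hx hy
      obtain rfl : p' = 0 := by have := SimplexCategory.le_of_epi α; omega
      obtain rfl := hom_zero_eq α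
      have hc : Cmp x' y' := by
        subst hx hy
        exact hxy.of_map (LP_of_epi _) (FP_of_epi _)
      rw [hZ.unitL _ _ _ (by omega) hc, cX_eq, cX_eq, mm, hy, mm]
      refine congrArg (fun f => X.map (Quiver.Hom.op f) y') (vl_ext fun i => ?_)
      simp only [vl_comp, vl_wedge, vl_ca, vl_id]
      split_ifs with h
      · have : i = 0 := Fin.ext (by simpa using h)
        subst this
        exact FP_of_epi β
      · simp only [Nat.zero_add, Nat.sub_zero]
  obtain _ | Q := q
  · refine ⟨x, fun _ => rfl, fun h => by omega, ?_, ?_⟩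
    · intro p' q' α β hα hβ hmα hmβ hlt
      obtain rfl : q' = 0 := by have := SimplexCategory.le_of_mono β; omega
      obtain rfl := hom_zero_eq β
      rw [hZ.unitR _ _ _ (by omega) (hxy.map hα hβ)]
      refine congrArg (fun f => X.map (Quiver.Hom.op f) x) (vl_ext fun i => ?_)
      have := i.isLt
      rw [vl_wedge, dif_pos (by omega)]
    · intro p' q' α β x' y' hα hβ hlt hx hy
      obtain rfl : q' = 0 := by have := SimplexCategory.le_of_epi β; omega
      obtain rfl := hom_zero_eq β
      have hc : Cmp x' y' := by
        subst hx hy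
        exact hxy.of_map (LP_of_epi _) (FP_of_epi _)
      rw [hZ.unitR _ _ _ (by omega) hc, hx]
      refine congrArg (fun f => X.map (Quiver.Hom.op f) x') (vl_ext fun i => ?_)
      have := i.isLt
      rw [vl_wedge, dif_pos (by omega)]
  obtain ⟨p₀, f, hf, x₀, hx₀⟩ := X.exists_nonDegenerate x
  obtain ⟨q₀, g, hg, y₀, hy₀⟩ := X.exists_nonDegenerate y
  have hp₀ := SimplexCategory.le_of_epi f
  have hq₀ := SimplexCategory.le_of_epi g
  have hc₀ : Cmp x₀.1 y₀.1 := by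
    rw [hx₀, hy₀] at hxy
    exact hxy.of_map (LP_of_epi _) (FP_of_epi _)
  by_cases hnd : p₀ + q₀ < n
  · refine ⟨X.map (wedge f g).op (Z p₀ q₀ x₀.1 y₀.1), fun h => by omega, fun h => by omega, ?_, ?_⟩
    · intro p' q' α β hα hβ hmα hmβ hlt
      rw [mm, wedge_comp _ _ (LP_of_epi f) (FP_of_epi g), hZ.nat _ _ _ _ _ _ _ _
        (LP_comp hα (LP_of_epi f)) (FP_comp hβ (FP_of_epi g)) hnd hlt hc₀, hx₀, hy₀, mm, mm]
    · intro p' q' α β x' y' hα hβ hlt hx hy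
      obtain ⟨a, ha, rfl, hfa⟩ := ez f hf x₀ hx₀ α hα x' hx
      obtain ⟨b, hb, rfl, hgb⟩ := ez g hg y₀ hy₀ β hβ y' hy
      rw [← hZ.nat _ _ _ _ _ _ _ _ (LP_of_epi a) (FP_of_epi b) hnd hlt hc₀, mm,
        wedge_comp _ _ (LP_of_epi a) (FP_of_epi b), hfa, hgb]
  · subst hn
    obtain ⟨z, hz1, hz2⟩ := fill P Q hZ x y hxy
    refine ⟨z, fun h => by omega, fun h => by omega, ?_, ?_⟩
    · intro p' q' α β hα hβ hmα hmβ hlt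
      by_cases hs : Function.Surjective α.toOrderHom
      · by_cases ht : Function.Surjective β.toOrderHom
        · have h1 : Epi α := SimplexCategory.epi_iff_surjective.2 hs
          have h2 : Epi β := SimplexCategory.epi_iff_surjective.2 ht
          have := SimplexCategory.le_of_epi α
          have := SimplexCategory.le_of_epi β
          omega
        · obtain ⟨j, β', rfl⟩ := SimplexCategory.eq_comp_δ_of_not_surjective β ht
          have hj : 0 < j.val := by
            by_contra h0
            have h3 := FP_right hβ
            unfold FP at h3
            rw [vl_δ] at h3
            have h4 : (if 0 < j.val then 0 else 0 + 1) = 0 := h3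
            rw [if_neg h0] at h4
            omega
          have hβ' : FP β' := by
            have h3 := hβ
            unfold FP at h3 ⊢
            rw [vl_comp, vl_δ] at h3
            dsimp only at h3
            split_ifs at h3
            omega
          have e : wedge α (β' ≫ SimplexCategory.δ j) =
              wedge α β' ≫ wedge (𝟙 _) (SimplexCategory.δ j) := by
            rw [wedge_comp _ _ (LP_id _) (FP_δ _ hj), Category.comp_id]
          rw [e, ← mm, hz2 j hj, hZ.nat _ _ _ _ _ _ _ _ hα hβ' (by omega) hlt
            (hxy.map (LP_id _) (FP_δ _ hj)), mm, mm, Category.comp_id]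
      · obtain ⟨j, α', rfl⟩ := SimplexCategory.eq_comp_δ_of_not_surjective α hs
        have hj : j.val < P + 1 := by
          by_contra h0
          have h3 := LP_right hα
          unfold LP at h3
          rw [vl_δ] at h3
          simp only [Fin.val_last] at h3
          split_ifs at h3 <;> omega
        have hα' : LP α' := by
          have h3 := hα
          unfold LP at h3 ⊢
          rw [vl_comp, vl_δ] at h3
          dsimp only at h3
          split_ifs at h3 <;> omega
        have e : wedge (α' ≫ SimplexCategory.δ j) β =
            wedge α' β ≫ wedge (SimplexCategory.δ j) (𝟙 _) := by
          rw [wedge_comp _ _ (LP_δ _ hj) (FP_id _), Category.comp_id]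
        rw [e, ← mm, hz1 j hj, hZ.nat _ _ _ _ _ _ _ _ hα' hβ (by omega) hlt
          (hxy.map (LP_δ _ hj) (FP_id _)), mm, mm, Category.comp_id]
    · intro p' q' α β x' y' hα hβ hlt hx hy
      obtain ⟨a, ha, -, -⟩ := ez f hf x₀ hx₀ α hα x' hx
      obtain ⟨b, hb, -, -⟩ := ez g hg y₀ hy₀ β hβ y' hy
      have := SimplexCategory.le_of_epi a
      have := SimplexCategory.le_of_epi b
      omega

open Classical in
lemma step [Quasicategory X] (hZ : Good X n Z) :
    ∃ Z' : ∀ p q : ℕ, X _⦋p⦌ → X _⦋q⦌ → X _⦋p + q⦌, Good X (n + 1) Z' ∧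
      ∀ p q, p + q < n → Z' p q = Z p q := by
  let Z' : ∀ p q : ℕ, X _⦋p⦌ → X _⦋q⦌ → X _⦋p + q⦌ := fun p q x y =>
    if h : p + q = n ∧ Cmp x y then (exists_step hZ p q h.1 x y h.2).choose else Z p q x y
  have hlt : ∀ p q, p + q < n → Z' p q = Z p q := fun p q h => by
    funext x y
    exact dif_neg (fun h' => by omega)
  have heq : ∀ p q (x : X _⦋p⦌) (y : X _⦋q⦌), p + q = n → Cmp x y →
      PP X n Z p q x y (Z' p q x y) := fun p q x y h hc => by
    have : Z' p q x y = (exists_step hZ p q h x y hc).choose := dif_pos ⟨h, hc⟩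
    rw [this]
    exact (exists_step hZ p q h x y hc).choose_spec
  -- naturality for monos and epis through lower dimension
  have hfac : ∀ (p q p' q' a b : ℕ) (e : (⦋p'⦌ : SimplexCategory) ⟶ ⦋a⦌)
      (m : (⦋a⦌ : SimplexCategory) ⟶ ⦋p⦌) (e' : (⦋q'⦌ : SimplexCategory) ⟶ ⦋b⦌)
      (m' : (⦋b⦌ : SimplexCategory) ⟶ ⦋q⦌) (x : X _⦋p⦌) (y : X _⦋q⦌),
      Epi e → Mono m → Epi e' → Mono m' → LP m → FP m' → p + q < n + 1 → p' + q' < n + 1 →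
      Cmp x y → a + b < n → X.map (wedge (e ≫ m) (e' ≫ m')).op (Z' p q x y) =
        Z' p' q' (X.map (e ≫ m).op x) (X.map (e' ≫ m').op y) := by
    intro p q p' q' a b e m e' m' x y he hm he' hm' hlm hfm h1 h2 hc hab
    have A : X.map (wedge m m').op (Z' p q x y) = Z a b (X.map m.op x) (X.map m'.op y) := by
      by_cases h : p + q < n
      · rw [hlt _ _ h]
        exact hZ.nat _ _ _ _ _ _ _ _ hlm hfm h hab hc
      · exact (heq p q x y (by omega) hc).face _ _ _ _ hlm hfm hm hm' hab
    have B : Z' p' q' (X.map (e ≫ m).op x) (X.map (e' ≫ m').op y) =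
        X.map (wedge e e').op (Z a b (X.map m.op x) (X.map m'.op y)) := by
      by_cases h : p' + q' < n
      · rw [hlt _ _ h, hZ.nat _ _ _ _ _ _ _ _ (LP_of_epi e) (FP_of_epi e') hab h
          (hc.map hlm hfm), mm, mm]
      · exact (heq p' q' _ _ (by omega) (hc.map (LP_comp (LP_of_epi e) hlm)
          (FP_comp (FP_of_epi e') hfm))).deg _ _ e e' _ _ he he' hab (mm _ _ _).symm (mm _ _ _).symm
    rw [B, ← A, mm, wedge_comp _ _ hlm hfm]
  refine ⟨Z', ⟨?_, ?_, ?_⟩, hlt⟩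
  · intro p x y hp hc
    by_cases h : p < n
    · rw [hlt p 0 h]
      exact hZ.unitR _ _ _ h hc
    · exact (heq p 0 x y (by omega) hc).r rfl
  · intro q x y hp hc
    by_cases h : q < n
    · rw [hlt 0 q (by omega)]
      exact hZ.unitL _ _ _ h hc
    · exact (heq 0 q x y (by omega) hc).l rfl
  · intro p q p' q' α β x y hα hβ h1 h2 hc
    obtain ⟨a, e, m, he, hm, rfl⟩ := factor α
    obtain ⟨b, e', m', he', hm', rfl⟩ := factor β
    have l1 := SimplexCategory.le_of_epi e
    have l2 := SimplexCategory.le_of_epi e'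
    have l3 := SimplexCategory.le_of_mono m
    have l4 := SimplexCategory.le_of_mono m'
    by_cases hab : a + b < n
    · exact hfac _ _ _ _ _ _ _ _ _ _ _ _ he hm he' hm' (LP_right hα) (FP_right hβ) h1 h2 hc hab
    · obtain rfl : a = p := by omega
      obtain rfl : a = p' := by omega
      obtain rfl : b = q := by omega
      obtain rfl : b = q' := by omega
      rw [SimplexCategory.eq_id_of_epi e, SimplexCategory.eq_id_of_epi e',
        SimplexCategory.eq_id_of_mono m, SimplexCategory.eq_id_of_mono m', Category.comp_id,
        Category.comp_id, wedge_id, mid, mid, mid]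

lemma exists_all (X : SSet.{u}) [Quasicategory X] :
    ∃ Z : ∀ p q : ℕ, X _⦋p⦌ → X _⦋q⦌ → X _⦋p + q⦌, ∀ n, Good X n Z := by
  let Y : ∀ n : ℕ, { Z : ∀ p q : ℕ, X _⦋p⦌ → X _⦋q⦌ → X _⦋p + q⦌ // Good X n Z } := fun n =>
    Nat.rec ⟨fun p q x y => X.map (wedge (𝟙 ⦋p⦌) (SimplexCategory.const ⦋q⦌ ⦋0⦌ 0)).op x,
      ⟨fun _ _ _ h => absurd h (Nat.not_lt_zero _), fun _ _ _ h => absurd h (Nat.not_lt_zero _),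
        fun _ _ _ _ _ _ _ _ _ _ h => absurd h (Nat.not_lt_zero _)⟩⟩
      (fun n z => ⟨(step z.2).choose, (step z.2).choose_spec.1⟩) n
  have hY : ∀ n p q, p + q < n → (Y (n + 1)).1 p q = (Y n).1 p q := fun n p q h =>
    (step (Y n).2).choose_spec.2 p q h
  have hY' : ∀ p q k, (Y (p + q + 1 + k)).1 p q = (Y (p + q + 1)).1 p q := by
    intro p q k
    induction k with
    | zero => rfl
    | succ k ih => rw [← ih]; exact hY (p + q + 1 + k) p q (by omega)
  have key : ∀ n p q, p + q < n → (Y (p + q + 1)).1 p q = (Y n).1 p q := by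
    intro n p q h
    obtain ⟨k, rfl⟩ : ∃ k, n = p + q + 1 + k := ⟨n - (p + q + 1), by omega⟩
    exact (hY' p q k).symm
  refine ⟨fun p q => (Y (p + q + 1)).1 p q, fun n => ⟨?_, ?_, ?_⟩⟩
  · intro p x y h hc
    rw [key n p 0 (by omega)]
    exact (Y n).2.unitR _ _ _ h hc
  · intro q x y h hc
    rw [key n 0 q (by omega)]
    exact (Y n).2.unitL _ _ _ h hc
  · intro p q p' q' α β x y hα hβ h1 h2 hc
    dsimp only
    rw [key n p q h1, key n p' q' h2]
    exact (Y n).2.nat _ _ _ _ _ _ _ _ hα hβ h1 h2 hc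

lemma LP_σ {m : ℕ} (j : Fin (m + 1)) : LP (SimplexCategory.σ j) := LP_of_epi _
lemma FP_σ {m : ℕ} (j : Fin (m + 1)) : FP (SimplexCategory.σ j) := FP_of_epi _

end NaF

/-- Every quasi-category admits a (strongly unital) nonassociative Frobenius structure. -/
theorem quasicategory_admits_naF (X : SSet) [SSet.Quasicategory X] :
    Nonempty (NaF.Struct X) := by
  obtain ⟨Z, hZ⟩ := NaF.exists_all X
  have hnat : ∀ (p q p' q' : ℕ) (α : (⦋p'⦌ : SimplexCategory) ⟶ ⦋p⦌)
    (β : (⦋q'⦌ : SimplexCategory) ⟶ ⦋q⦌) (x : X _⦋p⦌) (y : X _⦋q⦌),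
    NaF.LP α → NaF.FP β → NaF.Cmp x y →
    X.map (NaF.wedge α β).op (Z p q x y) = Z p' q' (X.map α.op x) (X.map β.op y) :=
    fun p q p' q' α β x y hα hβ hc =>
      (hZ (p + q + (p' + q') + 1)).nat _ _ _ _ _ _ _ _ hα hβ (by omega) (by omega) hc
  have hnatL : ∀ (p q p' : ℕ) (α : (⦋p'⦌ : SimplexCategory) ⟶ ⦋p⦌) (x : X _⦋p⦌) (y : X _⦋q⦌),
    NaF.LP α → NaF.Cmp x y →
    X.map (NaF.wedge α (𝟙 _)).op (Z p q x y) = Z p' q (X.map α.op x) y :=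
    fun p q p' α x y hα hc => by
      rw [hnat _ _ _ _ α (𝟙 _) x y hα (NaF.FP_id _) hc, NaF.mid]
  have hnatR : ∀ (p q q' : ℕ) (β : (⦋q'⦌ : SimplexCategory) ⟶ ⦋q⦌) (x : X _⦋p⦌) (y : X _⦋q⦌),
    NaF.FP β → NaF.Cmp x y →
    X.map (NaF.wedge (𝟙 _) β).op (Z p q x y) = Z p q' x (X.map β.op y) :=
    fun p q q' β x y hβ hc => by
      rw [hnat _ _ _ _ (𝟙 _) β x y (NaF.LP_id _) hβ hc, NaF.mid]
  have unitR : ∀ (p : ℕ) (x : X _⦋p⦌) (y : X _⦋0⦌), NaF.Cmp x y → Z p 0 x y = x :=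
    fun p x y hc => (hZ (p + 1)).unitR p x y (by omega) hc
  have unitL : ∀ (q : ℕ) (x : X _⦋0⦌) (y : X _⦋q⦌), NaF.Cmp x y →
      Z 0 q x y = NaF.cX X (Nat.zero_add q).symm y :=
    fun q x y hc => (hZ (q + 1)).unitL q x y (by omega) hc
  refine ⟨⟨Z, unitR, unitL, ?_, ?_, ?_, ?_, ?_, ?_, ?_, ?_⟩⟩
  · intro p q x y hc i hi hi'
    change X.map (SimplexCategory.δ _).op _ = Z p q (X.map (SimplexCategory.δ i).op x) y
    rw [← hnatL _ _ _ _ _ _ (NaF.LP_δ _ hi') hc, NaF.cX_eq, NaF.mm]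
    refine congrArg (fun f => X.map (Quiver.Hom.op f) (Z (p + 1) q x y)) (NaF.vl_ext fun k => ?_)
    have := k.isLt
    simp only [NaF.vl_comp, NaF.vl_δ, NaF.vl_wedge, NaF.vl_ca, NaF.vl_id]
    split_ifs <;> omega
  · intro p q x y hc i hi hi'
    change X.map (SimplexCategory.δ _).op _ = Z p q x (X.map (SimplexCategory.δ i).op y)
    rw [← hnatR _ _ _ _ _ _ (NaF.FP_δ _ hi) hc]
    refine congrArg (fun f => X.map (Quiver.Hom.op f) (Z p (q + 1) x y)) (NaF.vl_ext fun k => ?_)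
    have := k.isLt
    simp only [NaF.vl_comp, NaF.vl_δ, NaF.vl_wedge, NaF.vl_ca, NaF.vl_id]
    split_ifs <;> omega
  · intro p q x y hc i
    change X.map (SimplexCategory.σ _).op _ =
      NaF.cX X _ (Z (p + 1) q (X.map (SimplexCategory.σ i).op x) y)
    rw [← hnatL _ _ _ _ _ _ (NaF.LP_σ _) hc, NaF.cX_eq, NaF.mm]
    refine congrArg (fun f => X.map (Quiver.Hom.op f) (Z p q x y)) (NaF.vl_ext fun k => ?_)
    have := k.isLt
    simp only [NaF.vl_comp, NaF.vl_σ, NaF.vl_wedge, NaF.vl_ca, NaF.vl_id]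
    split_ifs <;> omega
  · intro p q x y hc i
    change X.map (SimplexCategory.σ _).op _ =
      Z p (q + 1) x (X.map (SimplexCategory.σ i).op y)
    rw [← hnatR _ _ _ _ _ _ (NaF.FP_σ _) hc]
    refine congrArg (fun f => X.map (Quiver.Hom.op f) (Z p q x y)) (NaF.vl_ext fun k => ?_)
    have := k.isLt
    simp only [NaF.vl_comp, NaF.vl_σ, NaF.vl_wedge, NaF.vl_ca, NaF.vl_id]
    split_ifs <;> omega
  · intro k r q x y hc
    have hb : NaF.FP (NaF.initSeg 0 q (Nat.zero_le q)) := rfl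
    have h1 := hnatR _ _ _ (NaF.initSeg 0 q (Nat.zero_le q)) x y hb hc
    rw [unitR _ _ _ (by
      unfold NaF.Cmp; rw [NaF.firstVertex_map hb]; exact hc)] at h1
    conv_rhs => rw [← h1]
    rw [NaF.mm]
    refine congrArg (fun f => X.map (Quiver.Hom.op f) (Z (k + r) q x y)) (NaF.vl_ext fun i => ?_)
    have := i.isLt
    simp only [NaF.vl_comp, NaF.vl_initSeg, NaF.vl_wedge, NaF.vl_ca, NaF.vl_id]
    split_ifs <;> omega
  · intro k r q x y hc
    have ha : NaF.LP (NaF.lastSeg r (k + r) (by omega)) := by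
      unfold NaF.LP; rw [NaF.vl_lastSeg]; simp only [Fin.val_last]; omega
    rw [← hnatL _ _ _ _ _ _ ha hc]
    refine congrArg (fun f => X.map (Quiver.Hom.op f) (Z (k + r) q x y)) (NaF.vl_ext fun i => ?_)
    have := i.isLt
    simp only [NaF.vl_comp, NaF.vl_lastSeg, NaF.vl_wedge, NaF.vl_ca, NaF.vl_id]
    split_ifs <;> omega
  · intro p j t x y hc
    have hb : NaF.FP (NaF.initSeg j (j + t) (by omega)) := rfl
    rw [← hnatR _ _ _ _ _ _ hb hc]
    refine congrArg (fun f => X.map (Quiver.Hom.op f) (Z p (j + t) x y)) (NaF.vl_ext fun i => ?_)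
    have := i.isLt
    simp only [NaF.vl_comp, NaF.vl_initSeg, NaF.vl_wedge, NaF.vl_ca, NaF.vl_id]
    split_ifs <;> omega
  · intro p j t x y hc
    have ha : NaF.LP (NaF.lastSeg 0 p (Nat.zero_le p)) := by
      unfold NaF.LP; rw [NaF.vl_lastSeg]; simp only [Fin.val_last]; omega
    have h1 := hnatL _ _ _ (NaF.lastSeg 0 p (Nat.zero_le p)) x y ha hc
    rw [unitL _ _ _ (by
      unfold NaF.Cmp; rw [NaF.lastVertex_map ha]; exact hc), NaF.cX_eq] at h1
    have h2 := congrArg (X.map (NaF.lastSeg t (0 + (j + t)) (by omega)).op) h1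
    rw [NaF.mm, NaF.mm] at h2
    have e : NaF.lastSeg t (0 + (j + t)) (by omega) ≫ NaF.ca (by omega) =
        NaF.lastSeg t (j + t) (by omega) := NaF.vl_ext fun i => by
      simp only [NaF.vl_comp, NaF.vl_lastSeg, NaF.vl_ca]
      omega
    rw [e] at h2
    rw [← h2]
    refine congrArg (fun f => X.map (Quiver.Hom.op f) (Z p (j + t) x y)) (NaF.vl_ext fun i => ?_)
    have := i.isLt
    simp only [NaF.vl_comp, NaF.vl_lastSeg, NaF.vl_wedge, NaF.vl_ca, NaF.vl_id]
    split_ifs <;> omega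
end

section
/- Let X be a quasi-category and n ≥ 2. For any two (n−1)-simplices y, z ∈ X_{n−1} with d_0(y) = d_{n−1}(z), there exists an n-simplex w ∈ X_n with d_n(w) = y and d_0(w) = z. In other words, every quasi-category lifts wedges: every map of simplicial sets W^n → X extends along the inclusion W^n ⊆ Δ^n. -/
open CategoryTheory Simplicial SSet

universe u

namespace WedgeProof

/-- The wedge as a subcomplex. -/
def wedge (m : ℕ) : (Δ[m + 2] : SSet.{u}).Subcomplex :=
  stdSimplex.face {(0 : Fin (m + 3))}ᶜ ⊔ stdSimplex.face {Fin.last (m + 2)}ᶜ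

lemma notMem_wedge_iff {m d : ℕ} (x : (Δ[m + 2] : SSet.{u}) _⦋d⦌) :
    x ∉ (wedge m).obj _ ↔ x 0 = 0 ∧ x (Fin.last d) = Fin.last (m + 2) := by
  have h : x ∈ (wedge m).obj _ ↔ (x ∈ (stdSimplex.face {(0 : Fin (m + 3))}ᶜ).obj _ ∨
    x ∈ (stdSimplex.face {Fin.last (m + 2)}ᶜ).obj _) := Iff.rfl
  rw [h, stdSimplex.mem_face_iff, stdSimplex.mem_face_iff]
  simp only [Finset.mem_compl, Finset.mem_singleton, not_or, not_forall, not_not]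
  constructor
  · rintro ⟨⟨i, hi⟩, ⟨j, hj⟩⟩
    have h1 := stdSimplex.monotone_apply x (Fin.zero_le i)
    have h2 := stdSimplex.monotone_apply x (Fin.le_last j)
    exact ⟨Fin.le_zero_iff.1 (hi ▸ h1), Fin.last_le_iff.1 (hj ▸ h2)⟩
  · rintro ⟨h1, h2⟩
    exact ⟨⟨_, h1⟩, ⟨_, h2⟩⟩

/-- Index type of the pairing. -/
structure Idx (m : ℕ) : Type u where
  d : ℕ
  x : (Δ[m + 2] : SSet.{u}) _⦋d + 2⦌
  mono : StrictMono x
  zero : x 0 = 0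
  one : x 1 = 1
  last : x (Fin.last _) = Fin.last _

lemma δ_zero {m : ℕ} (s : Idx.{u} m) : (Δ[m + 2] : SSet.{u}).δ 1 s.x 0 = 0 := by
  rw [stdSimplex.δ_apply]
  simpa using s.zero

lemma δ_succ {m : ℕ} (s : Idx.{u} m) (i : Fin (s.d + 1)) :
    (Δ[m + 2] : SSet.{u}).δ 1 s.x i.succ = s.x i.succ.succ := by
  rw [stdSimplex.δ_apply]
  congr 1

lemma δ_ne_one {m : ℕ} (s : Idx.{u} m) (i : Fin (s.d + 2)) :
    (Δ[m + 2] : SSet.{u}).δ 1 s.x i ≠ 1 := by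
  rw [stdSimplex.δ_apply, ← s.one]
  exact fun h ↦ Fin.succAbove_ne _ _ (s.mono.injective h)

lemma δ_mono {m : ℕ} (s : Idx.{u} m) :
    StrictMono ((Δ[m + 2] : SSet.{u}).δ 1 s.x) := by
  intro i j h
  rw [stdSimplex.δ_apply, stdSimplex.δ_apply]
  exact s.mono (Fin.strictMono_succAbove _ h)

lemma δ_last {m : ℕ} (s : Idx.{u} m) :
    (Δ[m + 2] : SSet.{u}).δ 1 s.x (Fin.last _) = Fin.last _ := by
  rw [← Fin.succ_last, δ_succ]
  exact s.last

lemma Idx.ext_δ {m : ℕ} (s t : Idx.{u} m)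
    (h : S.mk ((Δ[m + 2] : SSet.{u}).δ 1 s.x) = S.mk ((Δ[m + 2] : SSet.{u}).δ 1 t.x)) :
    s = t := by
  have hd : s.d = t.d := by
    have := congrArg S.dim h
    simpa using this
  have ht1 := δ_succ t
  have hs1 := δ_succ s
  obtain ⟨d, x, h1, h2, h3, h4⟩ := s
  obtain ⟨d', y, h1', h2', h3', h4'⟩ := t
  obtain rfl : d = d' := hd
  obtain rfl : x = y := by
    apply SSet.stdSimplex.ext
    intro i
    induction i using Fin.cases with
    | zero => exact h2.trans h2'.symm
    | succ i =>
      induction i using Fin.cases with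
      | zero => exact h3.trans h3'.symm
      | succ i =>
        have e : (Δ[m + 2] : SSet.{u}).δ 1 x = (Δ[m + 2] : SSet.{u}).δ 1 y := (S.ext_iff _ _).1 h
        rw [← ht1, ← hs1]
        dsimp only
        rw [e]
  rfl

lemma exists_one {m d : ℕ} (x : (Δ[m + 2] : SSet.{u}) _⦋d⦌) (hx : StrictMono x)
    (h0 : x 0 = 0) (h1 : x (Fin.last d) = Fin.last (m + 2)) (i : Fin (d + 1)) (hi : x i = 1) :
    ∃ s : Idx.{u} m, S.mk x = S.mk s.x := by
  obtain _ | _ | d := d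
  · exfalso
    have h2 : x 0 = Fin.last _ := h1
    rw [h0] at h2
    simp [Fin.ext_iff] at h2
  · exfalso
    fin_cases i
    · exact absurd (h0.symm.trans hi) (by simp)
    · have h2 : x 1 = Fin.last _ := h1
      have h3 : x 1 = 1 := hi
      rw [h3] at h2
      simp [Fin.ext_iff] at h2
  · refine ⟨⟨d, x, hx, h0, ?_, h1⟩, rfl⟩
    have hi0 : i ≠ 0 := by rintro rfl; exact absurd (h0.symm.trans hi) (by simp)
    have h2 : (1 : Fin (d + 3)) ≤ i := Fin.one_le_of_ne_zero hi0
    have h3 : x 1 ≤ x i := stdSimplex.monotone_apply x h2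
    have h4 := hx (show (0 : Fin (d + 3)) < 1 by simp)
    rw [hi] at h3
    rw [h0] at h4
    exact le_antisymm h3 (Fin.one_le_of_ne_zero h4.ne')

lemma exists_not_one {m d : ℕ} (x : (Δ[m + 2] : SSet.{u}) _⦋d⦌) (hx : StrictMono x)
    (h0 : x 0 = 0) (h1 : x (Fin.last d) = Fin.last (m + 2)) (hi : ∀ i, x i ≠ 1) :
    ∃ s : Idx.{u} m, S.mk x = S.mk ((Δ[m + 2] : SSet.{u}).δ 1 s.x) := by
  obtain _ | d := d
  · exfalso
    have h2 : x 0 = Fin.last _ := h1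
    rw [h0] at h2
    simp [Fin.ext_iff] at h2
  · let f : Fin (d + 3) → Fin (m + 3) :=
      Fin.cons 0 (Fin.cons 1 (fun i : Fin (d + 1) ↦ x i.succ))
    have hf : StrictMono f := by
      rw [Fin.strictMono_iff_lt_succ]
      intro i
      induction i using Fin.cases with
      | zero => simp [f]
      | succ i =>
        induction i using Fin.cases with
        | zero =>
          change (1 : Fin (m + 3)) < x (Fin.succ 0)
          have h2 := hx (Fin.succ_pos (0 : Fin (d + 1)))
          rw [h0] at h2
          exact lt_of_le_of_ne (Fin.one_le_of_ne_zero h2.ne') (hi _).symm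
        | succ i =>
          change x i.castSucc.succ < x i.succ.succ
          exact hx (by simp)
    let y : (Δ[m + 2] : SSet.{u}) _⦋d + 2⦌ := stdSimplex.objMk ⟨f, hf.monotone⟩
    have hy : ∀ i, y i = f i := fun _ ↦ rfl
    let s : Idx.{u} m := ⟨d, y, hf, rfl, rfl, h1⟩
    refine ⟨s, ?_⟩
    have : x = (Δ[m + 2] : SSet.{u}).δ 1 s.x := by
      apply SSet.stdSimplex.ext
      intro i
      induction i using Fin.cases with
      | zero => exact h0.trans (δ_zero s).symm
      | succ i => exact (δ_succ s i).symm
    rw [this]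

/-- The pairing. -/
def core (m : ℕ) : (wedge.{u} m).PairingCore where
  ι := Idx.{u} m
  dim s := s.d + 1
  simplex s := s.x
  index s := 1
  nonDegenerate₁ s := (stdSimplex.mem_nonDegenerate_iff_strictMono _).2 s.mono
  nonDegenerate₂ s := (stdSimplex.mem_nonDegenerate_iff_strictMono _).2 (δ_mono s)
  notMem₁ s := (notMem_wedge_iff _).2 ⟨s.zero, s.last⟩
  notMem₂ s := (notMem_wedge_iff _).2 ⟨δ_zero s, δ_last s⟩
  injective_type₁' {s t} h := by
    obtain ⟨d, x, h1, h2, h3, h4⟩ := s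
    obtain ⟨d', y, h1', h2', h3', h4'⟩ := t
    have hd : d = d' := by
      have := congrArg S.dim h
      simpa using this
    subst hd
    obtain rfl : x = y := (S.ext_iff _ _).1 h
    rfl
  injective_type₂' {s t} h := Idx.ext_δ s t h
  type₁_ne_type₂' s t h := by
    have h' := s.one
    have key : ∀ (a b : (Δ[m + 2] : SSet.{u}).S), a = b → ∀ i, a.simplex i = 1 →
      ∃ j, b.simplex j = 1 := by
      rintro a _ rfl i hi
      exact ⟨i, hi⟩
    obtain ⟨j, hj⟩ := key _ _ h 1 h'
    exact δ_ne_one t j hj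
  surjective' x := by
    have h1 := (stdSimplex.mem_nonDegenerate_iff_strictMono _).1 x.nonDegenerate
    obtain ⟨h2, h3⟩ := (notMem_wedge_iff _).1 x.notMem
    by_cases h : ∃ i, x.simplex i = 1
    · obtain ⟨i, hi⟩ := h
      obtain ⟨s, hs⟩ := exists_one _ h1 h2 h3 i hi
      exact ⟨s, Or.inl hs⟩
    · push Not at h
      obtain ⟨s, hs⟩ := exists_not_one _ h1 h2 h3 h
      exact ⟨s, Or.inr hs⟩

instance (m : ℕ) : (core.{u} m).IsInner where
  ne_zero s := by
    change (1 : Fin (s.d + 3)) ≠ 0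
    simp
  ne_last s := by
    change (1 : Fin (s.d + 3)) ≠ Fin.last _
    simp [Fin.ext_iff]

lemma lt_of_rel {m : ℕ} (s t : Idx.{u} m) (h : (core.{u} m).AncestralRel s t) : s.d < t.d := by
  obtain ⟨hne, hlt⟩ := h
  have hd : s.d + 1 < t.d + 2 := SSet.N.dim_lt_of_lt hlt
  obtain hd | hd := (show s.d ≤ t.d by omega).lt_or_eq
  · exact hd
  exfalso
  apply hne
  obtain ⟨f, hf, hf'⟩ := SSet.N.le_iff_exists_mono.1 hlt.le
  have hs := δ_ne_one s
  have key := Idx.ext_δ s t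
  clear hne hlt
  obtain ⟨d, x, h1, h2, h3, h4⟩ := s
  obtain ⟨d', y, h1', h2', h3', h4'⟩ := t
  obtain rfl : d = d' := hd
  apply key
  change ⦋d + 1⦌ ⟶ ⦋d + 2⦌ at f
  change @Mono _ _ ⦋d + 1⦌ ⦋d + 2⦌ f at hf
  obtain ⟨i, rfl⟩ := SimplexCategory.eq_δ_of_mono f
  have e : (Δ[m + 2] : SSet.{u}).δ i y = (Δ[m + 2] : SSet.{u}).δ 1 x := hf'
  have hi : i = 1 := by
    by_contra hi
    obtain ⟨j, hj⟩ := Fin.exists_succAbove_eq (Ne.symm hi)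
    apply hs j
    dsimp only
    rw [← e, stdSimplex.δ_apply, hj]
    exact h3'
  subst hi
  exact (S.ext_iff _ _).2 e.symm

instance (m : ℕ) : (core.{u} m).IsRegular :=
  Subcomplex.PairingCore.RankFunction.isRegular (α := ℕ)
    { rank := fun s ↦ s.d
      lt := fun h ↦ lt_of_rel _ _ h }

lemma wedge_inner (m : ℕ) : innerAnodyneExtensions (wedge.{u} m).ι :=
  (core m).pairing.innerAnodyneExtensions

lemma wsq (m : ℕ) : Subcomplex.BicartSq.{u} (stdSimplex.face {(0 : Fin (m + 3)), Fin.last (m + 2)}ᶜ)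
    (stdSimplex.face {(0 : Fin (m + 3))}ᶜ) (stdSimplex.face {Fin.last (m + 2)}ᶜ) (wedge m) where
  sup_eq := rfl
  inf_eq := by
    rw [stdSimplex.face_inter_face]
    congr 1
    ext; simp

end WedgeProof

open WedgeProof
theorem quasicategory_lifts_wedges (X : SSet) [SSet.Quasicategory X] (m : ℕ)
    (y z : X _⦋m + 1⦌) (h : X.δ 0 y = X.δ (Fin.last (m + 1)) z) :
    ∃ w : X _⦋m + 2⦌, X.δ (Fin.last (m + 2)) w = y ∧ X.δ 0 w = z := by
  have h0 : (0 : Fin (m + 3)) < Fin.last (m + 2) := Fin.last_pos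
  let a := (stdSimplex.faceSingletonComplIso (0 : Fin (m + 3))).inv ≫ yonedaEquiv.symm z
  let b := (stdSimplex.faceSingletonComplIso (Fin.last (m + 2))).inv ≫ yonedaEquiv.symm y
  have hab : Subcomplex.homOfLE (wsq m).le₁₂ ≫ a = Subcomplex.homOfLE (wsq m).le₁₃ ≫ b := by
    have e1 := stdSimplex.homOfLE_faceSingletonComplIso_inv_eq_facePairComplIso_inv_δ_pred _ _ h0
    have e2 := stdSimplex.homOfLE_faceSingletonComplIso_inv_eq_facePairComplIso_inv_δ_castPred _ _ h0
    dsimp only [a, b]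
    rw [reassoc_of% e1, reassoc_of% e2, stdSimplex.δ_comp_yonedaEquiv_symm,
      stdSimplex.δ_comp_yonedaEquiv_symm]
    congr 2
    exact h.symm
  let c : (wedge m : SSet) ⟶ X := (wsq m).isPushout.desc a b hab
  have := wedge_inner m _ (mem_innerFibrations (Limits.terminal.from X))
  have sqc : CommSq c (wedge m).ι (Limits.terminal.from X) (Limits.terminal.from _) :=
    ⟨Subsingleton.elim _ _⟩
  have hl : (wedge m).ι ≫ sqc.lift = c := sqc.fac_left
  have ha : Subcomplex.homOfLE (wsq m).le₂₄ ≫ c = a := (wsq m).isPushout.inl_desc _ _ _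
  have hb : Subcomplex.homOfLE (wsq m).le₃₄ ≫ c = b := (wsq m).isPushout.inr_desc _ _ _
  refine ⟨yonedaEquiv sqc.lift, ?_, ?_⟩
  · rw [← stdSimplex.yonedaEquiv_δ_comp, ← Equiv.eq_symm_apply,
      ← stdSimplex.faceSingletonComplIso_hom_ι, Category.assoc, ← Iso.eq_inv_comp]
    rw [← hl] at hb
    exact hb
  · rw [← stdSimplex.yonedaEquiv_δ_comp, ← Equiv.eq_symm_apply,
      ← stdSimplex.faceSingletonComplIso_hom_ι, Category.assoc, ← Iso.eq_inv_comp]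
    rw [← hl] at ha
    exact ha
end

section
/- For every n ≥ 2, the inclusion W^n ↪ Δ^n of the n-th wedge into the standard n-simplex is inner anodyne; equivalently, it has the left lifting property with respect to every morphism of simplicial sets that has the right lifting property with respect to all inner horn inclusions Λ^m_k ⊆ Δ^m (0 < k < m). -/
open CategoryTheory Simplicial SSet

/-- The `n`-th wedge `W^n`: the simplicial subset of the standard simplex `Δ[n]`
consisting of those simplices `f : [m] → [n]` with `f(m) ≤ n - 1` or `f(0) ≥ 1`. -/
def wedge (n : ℕ) : SSet where
  obj m := { α : Δ[n].obj m //
    (stdSimplex.asOrderHom α (Fin.last m.unop.len)).val < n ∨ 0 < (stdSimplex.asOrderHom α 0).val }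
  map f := ↾fun α => ⟨Δ[n].map f α.1, by
    rcases α.2 with h | h
    · exact Or.inl (lt_of_le_of_lt
        (Fin.le_def.mp ((stdSimplex.asOrderHom α.1).monotone (Fin.le_last _))) h)
    · exact Or.inr (lt_of_lt_of_le h
        (Fin.le_def.mp ((stdSimplex.asOrderHom α.1).monotone (Fin.zero_le _))))⟩

/-- The inclusion of the `n`-th wedge into the standard simplex. -/
def wedgeInclusion (n : ℕ) : wedge n ⟶ Δ[n] where
  app m := ↾fun (α : { α : Δ[n].obj m // _ }) => α

namespace WedgeAux

universe u

/-- The image of the wedge inclusion, as a subcomplex. -/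
abbrev A (n : ℕ) : (Δ[n] : SSet.{u}).Subcomplex := Subcomplex.range (wedgeInclusion.{u} n)

lemma mem_A {n d : ℕ} (x : (Δ[n] : SSet.{u}) _⦋d⦌) :
    x ∈ (A.{u} n).obj _ ↔ ((x (Fin.last d)).val < n ∨ 0 < (x 0).val) := by
  constructor
  · rintro ⟨⟨y, hy⟩, rfl⟩
    exact hy
  · intro h
    exact ⟨⟨x, h⟩, rfl⟩

lemma notMem_A {n d : ℕ} (x : (Δ[n] : SSet.{u}) _⦋d⦌) :
    x ∉ (A.{u} n).obj _ ↔ ((x (Fin.last d)).val = n ∧ (x 0).val = 0) := by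
  rw [mem_A]
  have := (x (Fin.last d)).isLt
  omega

/-- Type (I) simplices. -/
structure Idx (n : ℕ) : Type u where
  d : ℕ
  x : (Δ[n] : SSet.{u}) _⦋d + 2⦌
  mono : StrictMono x
  h0 : (x 0).val = 0
  h1 : (x 1).val = 1
  hl : (x (Fin.last _)).val = n

lemma Idx.ext' {n : ℕ} {s t : Idx.{u} n} (hd : s.d = t.d)
    (h : ∀ (i j : ℕ) (hi : i < s.d + 3) (hj : j < t.d + 3), i = j →
      s.x ⟨i, hi⟩ = t.x ⟨j, hj⟩) : s = t := by
  obtain ⟨d, x, _, _, _, _⟩ := s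
  obtain ⟨e, y, _, _, _, _⟩ := t
  obtain rfl : d = e := hd
  obtain rfl : x = y := by
    apply SSet.stdSimplex.ext
    intro i
    exact h i i i.2 i.2 rfl
  rfl

lemma mk_eq {n d e : ℕ} {x : (Δ[n] : SSet.{u}) _⦋d⦌} {y : (Δ[n] : SSet.{u}) _⦋e⦌}
    (h : S.mk x = S.mk y) : d = e ∧ ∀ (i j : ℕ) (hi : i < d + 1) (hj : j < e + 1), i = j →
      x ⟨i, hi⟩ = y ⟨j, hj⟩ := by
  obtain rfl : d = e := congrArg S.dim h
  rw [S.ext_iff] at h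
  subst h
  refine ⟨rfl, ?_⟩
  rintro i _ _ _ rfl
  rfl

lemma one_lt {n : ℕ} (s : Idx.{u} n) (i : Fin (s.d + 3)) (hi : 2 ≤ i.val) : 1 < (s.x i).val := by
  have := s.mono (show (1 : Fin (s.d + 3)) < i from by
    rw [Fin.lt_def]; exact lt_of_lt_of_le (by simp) hi)
  have h1 := s.h1
  rw [Fin.lt_def] at this
  omega

lemma face_ne_one {n : ℕ} (s : Idx.{u} n) (i : Fin (s.d + 2)) :
    ((Δ[n] : SSet.{u}).δ 1 s.x i).val ≠ 1 := by
  rw [stdSimplex.δ_apply]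
  induction i using Fin.cases with
  | zero =>
    have : (1 : Fin (s.d + 3)).succAbove 0 = 0 := by simp
    rw [this, s.h0]; simp
  | succ i =>
    have : (1 : Fin (s.d + 3)).succAbove i.succ = i.succ.succ := by
      apply Fin.succAbove_of_le_castSucc
      rw [Fin.le_def]; simp
    rw [this]
    have := one_lt s i.succ.succ (by simp)
    omega

lemma succAbove_one_succ {d : ℕ} (i : Fin (d + 1)) :
    (1 : Fin (d + 3)).succAbove i.succ = i.succ.succ := by
  apply Fin.succAbove_of_le_castSucc
  rw [Fin.le_def]; simp

/-- The pairing. -/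
noncomputable def core (n : ℕ) (hn : 2 ≤ n) : (A.{u} n).PairingCore where
  ι := Idx.{u} n
  dim s := s.d + 1
  simplex s := s.x
  index s := 1
  nonDegenerate₁ s := by
    rw [stdSimplex.mem_nonDegenerate_iff_strictMono]
    exact s.mono
  nonDegenerate₂ s := by
    rw [stdSimplex.mem_nonDegenerate_iff_strictMono]
    exact s.mono.comp (Fin.strictMono_succAbove 1)
  notMem₁ s := by
    rw [notMem_A]
    exact ⟨s.hl, s.h0⟩
  notMem₂ s := by
    rw [notMem_A, stdSimplex.δ_apply, stdSimplex.δ_apply]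
    have h0 : (1 : Fin (s.d + 3)).succAbove 0 = 0 := by simp
    have h1 : (1 : Fin (s.d + 3)).succAbove (Fin.last _) = Fin.last _ := by
      rw [← Fin.succ_last, succAbove_one_succ, Fin.succ_last, Fin.succ_last]
    rw [h0, h1]
    exact ⟨s.hl, s.h0⟩
  injective_type₁' {s t} h := by
    obtain ⟨h1, h2⟩ := mk_eq h
    exact Idx.ext' (by omega) h2
  injective_type₂' {s t} h := by
    obtain ⟨h1, h2⟩ := mk_eq h
    refine Idx.ext' (by omega) ?_
    rintro i _ hi hj rfl
    rcases i with _ | _ | i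
    · exact Fin.ext (s.h0.trans t.h0.symm)
    · exact Fin.ext (s.h1.trans t.h1.symm)
    · have := h2 (i + 1) (i + 1) (by omega) (by omega) rfl
      rw [stdSimplex.δ_apply, stdSimplex.δ_apply] at this
      have e1 := succAbove_one_succ (d := s.d) ⟨i, by omega⟩
      have e2 := succAbove_one_succ (d := t.d) ⟨i, by omega⟩
      simp only [Fin.succ_mk] at e1 e2
      rw [e1, e2] at this
      exact this
  type₁_ne_type₂' s t h := by
    obtain ⟨h1, h2⟩ := mk_eq h
    have := h2 1 1 (by omega) (by omega) rfl
    refine face_ne_one t ⟨1, by omega⟩ ?_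
    rw [← this]
    exact s.h1
  surjective' x := by
    obtain ⟨d, x, hx, hx', rfl⟩ := x.mk_surjective
    rw [stdSimplex.mem_nonDegenerate_iff_strictMono] at hx
    rw [notMem_A] at hx'
    obtain ⟨hl, h0⟩ := hx'
    rcases d with _ | d
    · exfalso
      have : (Fin.last 0) = 0 := rfl
      rw [this] at hl
      omega
    by_cases h1 : (x 1).val = 1
    · rcases d with _ | d
      · exfalso
        have : (Fin.last 1) = 1 := rfl
        rw [this] at hl
        omega
      exact ⟨⟨d, x, hx, h0, h1, hl⟩, Or.inl rfl⟩
    · have h2 : ∀ i : Fin (d + 1), 1 < (x i.succ).val := by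
        intro i
        have a1 : x 0 < x 1 := hx (by simp)
        have a2 : x 1 ≤ x i.succ := hx.monotone (by rw [Fin.le_def]; simp)
        rw [Fin.lt_def] at a1
        rw [Fin.le_def] at a2
        omega
      let f : Fin (d + 3) → Fin (n + 1) :=
        Fin.cons ⟨0, by omega⟩ (Fin.cons ⟨1, by omega⟩ (fun i => x i.succ))
      have hf : StrictMono f := by
        rw [Fin.strictMono_iff_lt_succ]
        intro i
        induction i using Fin.cases with
        | zero => simp [f, Fin.lt_def]
        | succ i =>
          induction i using Fin.cases with
          | zero => exact h2 0
          | succ i => exact hx (by simp [Fin.lt_def])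
      refine ⟨⟨d, stdSimplex.objMk ⟨f, hf.monotone⟩, hf, rfl, rfl, hl⟩, Or.inr ?_⟩
      change S.mk x = _
      rw [S.ext_iff]
      apply SSet.stdSimplex.ext
      intro i
      rw [stdSimplex.δ_apply]
      induction i using Fin.cases with
      | zero => exact Fin.ext h0
      | succ i => rw [succAbove_one_succ]; rfl

lemma core_lt {n : ℕ} {hn : 2 ≤ n} {s t : (core.{u} n hn).ι}
    (h : (core.{u} n hn).AncestralRel s t) : Idx.d s < Idx.d t := by
  obtain ⟨hne, hlt⟩ := h
  obtain ⟨f, hf, hf'⟩ := N.le_iff_exists_mono.1 (Subcomplex.N.lt_iff.1 hlt).le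
  change ⦋Idx.d s + 1⦌ ⟶ ⦋Idx.d t + 2⦌ at f
  obtain ⟨g, rfl⟩ := SimplexCategory.eq_comp_δ_of_not_surjective' f 1 (by
    intro i hi
    refine face_ne_one s i ?_
    have h3 := DFunLike.congr_fun (F := (Δ[n] : SSet.{u}) _⦋Idx.d s + 1⦌) hf' i
    change Idx.x t (f.toOrderHom i) = _ at h3
    rw [hi] at h3
    exact (congrArg Fin.val h3).symm.trans (Idx.h1 t))
  have hle : (core n hn).type₂ s ≤ (core n hn).type₂ t := by
    rw [Subcomplex.N.le_iff, N.le_iff_exists_mono]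
    exact ⟨g, @mono_of_mono _ _ _ _ _ g (SimplexCategory.δ 1) hf, hf'⟩
  have hlt' := lt_of_le_of_ne hle (fun e => hne ((core n hn).injective_type₂ e))
  have := SSet.N.dim_lt_of_lt (Subcomplex.N.lt_iff.1 hlt')
  change Idx.d s + 1 < Idx.d t + 1 at this
  omega

lemma strong (n : ℕ) (hn : 2 ≤ n) :
    strongInnerAnodyneExtensions (wedgeInclusion.{u} n) := by
  have hmono : Mono (wedgeInclusion.{u} n) := by
    rw [NatTrans.mono_iff_mono_app]
    intro m
    rw [mono_iff_injective]
    exact Subtype.val_injective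
  have : (core.{u} n hn).IsRegular :=
    Subcomplex.PairingCore.RankFunction.isRegular (α := ℕ)
      ⟨fun s => Idx.d s, fun h => core_lt h⟩
  have : (core.{u} n hn).IsInner :=
    { ne_zero := fun s => by
        change (1 : Fin (Idx.d s + 3)) ≠ 0
        simp
      ne_last := fun s => by
        change (1 : Fin (Idx.d s + 3)) ≠ Fin.last _
        simp [Fin.ext_iff] }
  exact ⟨hmono, (core.{u} n hn).pairing, inferInstance, inferInstance⟩

end WedgeAux

/-- For every `n ≥ 2`, the inclusion `W^n ↪ Δ[n]` is inner anodyne: it has the left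
lifting property with respect to every morphism of simplicial sets having the right
lifting property with respect to all inner horn inclusions `Λ[m, i] ⊆ Δ[m]`
(`0 < i < m`). -/
theorem wedge_inclusion_innerAnodyne (n : ℕ) (hn : 2 ≤ n) {E B : SSet} (p : E ⟶ B)
    (hp : ∀ (m : ℕ) (i : Fin (m + 1)), 0 < i → i < Fin.last m →
      HasLiftingProperty Λ[m, i].ι p) :
    HasLiftingProperty (wedgeInclusion n) p := by
  refine strongInnerAnodyneExtensions_le_innerAnodyneExtensions _ (WedgeAux.strong n hn) p ?_
  rintro _ _ _ ⟨i, h0, hl⟩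
  exact hp _ _ h0 hl
end

section
/- There exists a simplicial set X which admits a (strongly unital) nonassociative Frobenius structure but which is not a quasi-category. Hence the converse of the statement 'every quasi-category admits a nonassociative Frobenius structure' is false. -/
open CategoryTheory Simplicial SSet

namespace NaFEx

universe u

/-- Three edge labels. -/
inductive E : Type u where
  | z
  | o
  | t

/-- The unital magma: `z` is the unit, all other products are `t`. -/
noncomputable def E.mul (a b : E.{u}) : E.{u} :=
  open Classical in if a = .z then b else if b = .z then a else .t

set_option linter.unusedVariables false
set_option linter.unusedSimpArgs false

/-- Labelings of the edges of the simplex avoiding the triangle `(o, o, z)`. -/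
def Good {n : ℕ} (x : Fin (n + 1) → Fin (n + 1) → E.{u}) : Prop :=
  (∀ i j, j ≤ i → x i j = .z) ∧ ∀ i j k, x i j = .o → x j k = .o → x i k ≠ .z

/-- The counterexample. -/
def XX : SSet.{u} where
  obj Δ := {x : Fin (Δ.unop.len + 1) → Fin (Δ.unop.len + 1) → E.{u} // Good x}
  map f := TypeCat.ofHom fun x => ⟨fun i j => x.1 (f.unop.toOrderHom i) (f.unop.toOrderHom j),
    fun i j h => x.2.1 _ _ (f.unop.toOrderHom.monotone h), fun i j k => x.2.2 _ _ _⟩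
  map_id _ := rfl
  map_comp _ _ := rfl

/-- The label of a crossing edge. -/
noncomputable def zfun {p q : ℕ} (x : Fin (p + 1) → Fin (p + 1) → E.{u})
    (y : Fin (q + 1) → Fin (q + 1) → E.{u}) (i j : Fin (p + q + 1)) : E.{u} :=
  if hj : j.1 ≤ p then
    if hi : i.1 ≤ p then x ⟨i.1, by omega⟩ ⟨j.1, by omega⟩ else .z
  else if hi : i.1 ≤ p then
    E.mul (x ⟨i.1, by omega⟩ ⟨p, by omega⟩) (y ⟨0, by omega⟩ ⟨j.1 - p, by omega⟩)
  else y ⟨i.1 - p, by omega⟩ ⟨j.1 - p, by omega⟩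

lemma mul_z (a : E.{u}) : E.mul a .z = a := by cases a <;> simp [E.mul]
lemma z_mul (a : E.{u}) : E.mul .z a = a := by cases a <;> simp [E.mul]
lemma mul_eq_o (a b : E.{u}) : E.mul a b = .o ↔ (a = .o ∧ b = .z) ∨ (a = .z ∧ b = .o) := by
  cases a <;> cases b <;> simp [E.mul]
lemma mul_eq_z (a b : E.{u}) : E.mul a b = .z ↔ (a = .z ∧ b = .z) := by
  cases a <;> cases b <;> simp [E.mul]

lemma zfun_good {p q : ℕ} (x : Fin (p + 1) → Fin (p + 1) → E.{u})
    (y : Fin (q + 1) → Fin (q + 1) → E.{u}) (hx : Good x) (hy : Good y) :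
    Good (zfun x y) := by
  constructor
  · intro i j h
    have h' : j.1 ≤ i.1 := h
    unfold zfun
    split_ifs with h1 h2 h3
    · exact hx.1 _ _ h
    · rfl
    · omega
    · exact hy.1 _ _ (by simp only [Fin.mk_le_mk]; omega)
  · intro i j k
    unfold zfun
    split_ifs <;> simp only [mul_eq_o, mul_eq_z, ne_eq, reduceCtorEq, false_imp_iff, imp_true_iff, not_and]
    · exact hx.2 _ _ _
    · grind [hx.2 , hy.2]
    · grind [hx.2 , hy.2]
    · exact hy.2 _ _ _

/-- The operations. -/
noncomputable def ZZ (p q : ℕ) (x : XX.{u} _⦋p⦌) (y : XX.{u} _⦋q⦌) : XX.{u} _⦋p + q⦌ :=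
  ⟨zfun (p := p) (q := q) x.1 y.1, zfun_good (p := p) (q := q) _ _ x.2 y.2⟩

/-- Labels with natural number indices. -/
def ev {n : ℕ} (x : XX.{u} _⦋n⦌) (i j : ℕ) : E.{u} :=
  if h : i ≤ n ∧ j ≤ n then x.1 ⟨i, Nat.lt_succ_of_le h.1⟩ ⟨j, Nat.lt_succ_of_le h.2⟩ else .z

lemma ev_ext {n : ℕ} (x y : XX.{u} _⦋n⦌)
    (h : ∀ i j, i < j → j ≤ n → ev x i j = ev y i j) : x = y := by
  apply Subtype.ext
  funext i j
  obtain ⟨i, hi⟩ := i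
  obtain ⟨j, hj⟩ := j
  simp only [SimplexCategory.len_mk] at hi hj
  by_cases hij : i < j
  · have := h i j hij (by omega)
    unfold ev at this
    rwa [dif_pos ⟨by omega, by omega⟩, dif_pos ⟨by omega, by omega⟩] at this
  · rw [x.2.1 _ _ (by simp only [Fin.mk_le_mk]; omega), y.2.1 _ _ (by simp only [Fin.mk_le_mk]; omega)]

lemma ev_diag {n : ℕ} (x : XX.{u} _⦋n⦌) (i : ℕ) : ev x i i = .z := by
  unfold ev; split_ifs
  · exact x.2.1 _ _ le_rfl
  · rfl

lemma ev_cX {m n : ℕ} (h : m = n) (x : XX.{u} _⦋m⦌) (i j : ℕ) :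
    ev (NaF.cX XX h x) i j = ev x i j := by subst h; rfl

lemma ev_map {m n : ℕ} (f : (⦋m⦌ : SimplexCategory) ⟶ ⦋n⦌) (x : XX.{u} _⦋n⦌) (i j : ℕ)
    (hi : i ≤ m) (hj : j ≤ m) :
    ev (XX.map f.op x) i j =
      ev x (f.toOrderHom ⟨i, Nat.lt_succ_of_le hi⟩).1 (f.toOrderHom ⟨j, Nat.lt_succ_of_le hj⟩).1 := by
  unfold ev
  rw [dif_pos ⟨hi, hj⟩, dif_pos ⟨Nat.le_of_lt_succ (Fin.is_lt _), Nat.le_of_lt_succ (Fin.is_lt _)⟩]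
  rfl

lemma ev_init (k n : ℕ) (h : k ≤ n) (x : XX.{u} _⦋n⦌) (i j : ℕ) (hi : i ≤ k) (hj : j ≤ k) :
    ev (XX.map (NaF.initSeg k n h).op x) i j = ev x i j := ev_map _ x i j hi hj

lemma ev_last (k n : ℕ) (h : k ≤ n) (x : XX.{u} _⦋n⦌) (i j : ℕ) (hi : i ≤ k) (hj : j ≤ k) :
    ev (XX.map (NaF.lastSeg k n h).op x) i j = ev x (i + (n - k)) (j + (n - k)) :=
  ev_map _ x i j hi hj

lemma ev_δ {n : ℕ} (a : Fin (n + 2)) (x : XX.{u} _⦋n + 1⦌) (i j : ℕ) (hi : i ≤ n) (hj : j ≤ n) :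
    ev (XX.δ a x) i j = ev x (if i < a.1 then i else i + 1) (if j < a.1 then j else j + 1) := by
  refine (ev_map (SimplexCategory.δ a) x i j hi hj).trans ?_
  congr 1
  · change (Fin.succAbove a _).1 = _
    simp [Fin.succAbove, Fin.lt_def]; split_ifs <;> rfl
  · change (Fin.succAbove a _).1 = _
    simp [Fin.succAbove, Fin.lt_def]; split_ifs <;> rfl

lemma ev_σ {n : ℕ} (a : Fin (n + 1)) (x : XX.{u} _⦋n⦌) (i j : ℕ) (hi : i ≤ n + 1)
    (hj : j ≤ n + 1) :
    ev (XX.σ a x) i j = ev x (if i ≤ a.1 then i else i - 1) (if j ≤ a.1 then j else j - 1) := by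
  refine (ev_map (SimplexCategory.σ a) x i j hi hj).trans ?_
  congr 1
  · change (Fin.predAbove a _).1 = _
    simp [Fin.predAbove, Fin.lt_def]; split_ifs <;> first | rfl | omega
  · change (Fin.predAbove a _).1 = _
    simp [Fin.predAbove, Fin.lt_def]; split_ifs <;> first | rfl | omega

lemma ev_ZZ {p q : ℕ} (x : XX.{u} _⦋p⦌) (y : XX.{u} _⦋q⦌) (i j : ℕ) (hij : i < j)
    (hj : j ≤ p + q) :
    ev (ZZ p q x y) i j = if j ≤ p then ev x i j else if p ≤ i then ev y (i - p) (j - p) else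
      E.mul (ev x i p) (ev y 0 (j - p)) := by
  have e : ev (ZZ p q x y) i j =
      if j ≤ p then ev x i j else if i ≤ p then E.mul (ev x i p) (ev y 0 (j - p)) else
        ev y (i - p) (j - p) := by
    unfold ev
    rw [dif_pos ⟨by omega, by omega⟩]
    simp only [ZZ, zfun]
    split_ifs <;> first | rfl | omega
  rw [e]
  split_ifs with h1 h2 h3
  · rfl
  · obtain rfl : i = p := by omega
    simp [ev_diag, z_mul]
  · rfl
  · rfl
  · omega

/-- The naF structure. -/
noncomputable def str : NaF.Struct XX.{u} where
  Z := ZZ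
  unit_right p x y _ := by
    apply ev_ext; intro i j hij hj
    rw [ev_ZZ _ _ _ _ hij hj, if_pos (by omega)]
  unit_left q x y _ := by
    apply ev_ext; intro i j hij hj
    rw [ev_ZZ _ _ _ _ hij hj, if_neg (by omega), if_pos (by omega), ev_cX]; rfl
  d_inner_left p q x y _ a h0 h1 := by
    apply ev_ext; intro i j hij hj
    rw [ev_δ _ _ _ _ (by omega) (by omega), ev_cX, ev_ZZ _ _ _ _ (by grind) (by grind),
      ev_ZZ _ _ _ _ hij hj]
    have e := fun i j hi hj => ev_δ a x i j hi hj
    grind [ev_diag, mul_z, z_mul]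
  d_inner_right p q x y _ a h0 h1 := by
    apply ev_ext; intro i j hij hj
    rw [ev_δ _ _ _ _ (by omega) (by omega), ev_ZZ _ _ _ _ (by grind) (by grind),
      ev_ZZ _ _ _ _ hij hj]
    have e := fun i j hi hj => ev_δ a y i j hi hj
    grind [ev_diag, mul_z, z_mul]
  s_left p q x y _ a := by
    apply ev_ext; intro i j hij hj
    rw [ev_σ _ _ _ _ (by omega) (by omega), ev_cX, 
      ev_ZZ _ _ _ _ hij (by grind)]
    have e := fun i j hi hj => ev_σ a x i j hi hj
    have e2 := fun i j hi hj => ev_ZZ x y i j hi hj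
    have e3 := fun i => ev_diag (ZZ p q x y) i
    have e4 := ev_diag x p
    obtain ⟨a, ha⟩ := a
    by_cases h1 : i ≤ a <;> by_cases h2 : j ≤ a <;> simp only [h1, h2, if_true, if_false]
    · grind
    · by_cases h3 : i = j - 1
      · grind [mul_z, z_mul, ev_diag]
      · rw [e2 _ _ (by omega) (by omega)]
        by_cases h4 : i = p
        · subst h4
          obtain rfl : a = i := by omega
          have e5 : ev (XX.σ ⟨a, ha⟩ x) a (a + 1) = E.z := by
            rw [e _ _ (by omega) (by omega)]
            simpa using e4
          rw [if_neg (by omega), if_pos le_rfl, if_neg (by omega), if_neg (by omega), e5, z_mul]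
          congr 1 <;> omega
        · grind
    · omega
    · rw [e2 _ _ (by omega) (by omega)]
      by_cases h4 : i = p + 1
      · grind [mul_z, z_mul]
      · grind
  s_right p q x y _ a := by
    apply ev_ext; intro i j hij hj
    rw [ev_σ _ _ _ _ (by omega) (by omega), 
      ev_ZZ _ _ _ _ hij (by grind)]
    have e := fun i j hi hj => ev_σ a y i j hi hj
    have e2 := fun i j hi hj => ev_ZZ x y i j hi hj
    have e3 := fun i => ev_diag (ZZ p q x y) i
    have e4 := ev_diag y 0
    obtain ⟨a, ha⟩ := a
    simp only at e ⊢
    by_cases h1 : j ≤ p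
    · grind
    rw [if_neg h1]
    by_cases h2 : p ≤ i
    · rw [if_pos h2, e _ _ (by omega) (by omega)]
      by_cases h3 : (if i ≤ p + a then i else i - 1) = (if j ≤ p + a then j else j - 1)
      · rw [h3, e3]
        have h4 : (if i - p ≤ a then i - p else i - p - 1) =
          (if j - p ≤ a then j - p else j - p - 1) := by split_ifs at h3 ⊢ <;> omega
        rw [h4, ev_diag]
      · rw [e2 _ _ (by split_ifs at h3 ⊢ <;> omega) (by split_ifs <;> omega)]
        rw [if_neg (by split_ifs at h3 ⊢ <;> omega), if_pos (by split_ifs at h3 ⊢ <;> omega)]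
        congr 1 <;> split_ifs <;> omega
    · rw [if_neg h2, e _ _ (by omega) (by omega), if_pos (show i ≤ p + a by omega),
        if_pos (Nat.zero_le a), e2 _ _ (by split_ifs <;> omega) (by split_ifs <;> omega), if_neg h2]
      by_cases h3 : (if j ≤ p + a then j else j - 1) ≤ p
      · have h4 : (if j - p ≤ a then j - p else j - p - 1) = 0 := by split_ifs at h3 ⊢ <;> omega
        have h5 : (if j ≤ p + a then j else j - 1) = p := by split_ifs at h3 ⊢ <;> omega
        rw [h4, h5, e4, mul_z, if_pos le_rfl]
      · rw [if_neg h3]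
        congr 2
        split_ifs <;> omega
  frob_init_left k r q x y _ := by
    apply ev_ext; intro i j hij hj
    rw [ev_init _ _ _ _ _ _ (by omega) (by omega), ev_init _ _ _ _ _ _ (by omega) (by omega),
      ev_ZZ _ _ _ _ (by omega) (by omega), if_pos (by omega)]
  frob_last_left k r q x y _ := by
    apply ev_ext; intro i j hij hj
    rw [ev_last _ _ _ _ _ _ (by omega) (by omega),
      ev_ZZ _ _ _ _ (by omega) (by omega), ev_ZZ _ _ _ _ (by omega) (by omega)]
    have e := fun i j hi hj => ev_last r (k + r) (by omega) x i j hi hj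
    grind [ev_diag, mul_z, z_mul]
  frob_init_right p l t x y _ := by
    apply ev_ext; intro i j hij hj
    rw [ev_init _ _ _ _ _ _ (by omega) (by omega),
      ev_ZZ _ _ _ _ (by omega) (by omega), ev_ZZ _ _ _ _ (by omega) (by omega)]
    split_ifs
    · rfl
    · rw [ev_init _ _ _ _ _ _ (by omega) (by omega)]
    · rw [ev_init _ _ _ _ _ _ (by omega) (by omega)]
  frob_last_right p l t x y _ := by
    apply ev_ext; intro i j hij hj
    rw [ev_last _ _ _ _ _ _ (by omega) (by omega), ev_last _ _ _ _ _ _ (by omega) (by omega),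
      ev_ZZ _ _ _ _ (by omega) (by omega), if_neg (by omega), if_pos (by omega)]
    congr 1 <;> omega

/-- The labels of the bad horn. -/
def w (i j : Fin 4) : E.{u} :=
  if i = 0 ∧ j = 1 then .o else if i = 0 ∧ j = 2 then .o else if i = 2 ∧ j = 3 then .o else
  if i = 1 ∧ j = 3 then .t else .z

lemma w_mono : ∀ i j : Fin 4, j ≤ i → w.{u} i j = .z := by
  intro i j h; fin_cases i <;> fin_cases j <;> first | rfl | (exact absurd h (by decide))

lemma w_bad : ∀ i j k : Fin 4, w.{u} i j = .o → w.{u} j k = .o → w.{u} i k = .z →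
    i = 0 ∧ j = 2 ∧ k = 3 := by
  intro i j k; fin_cases i <;> fin_cases j <;> fin_cases k <;> simp [w]

/-- The bad horn. -/
def hornMap : (Λ[3, 1] : SSet.{u}) ⟶ XX.{u} where
  app Δ := TypeCat.ofHom fun f => ⟨fun i j => w (SSet.stdSimplex.objEquiv f.1 |>.toOrderHom i)
      (SSet.stdSimplex.objEquiv f.1 |>.toOrderHom j),
    fun i j h => w_mono _ _ ((SSet.stdSimplex.objEquiv f.1).toOrderHom.monotone h),
    fun i j k h1 h2 h3 => by
      obtain ⟨e1, e2, e3⟩ := w_bad _ _ _ h1 h2 h3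
      apply f.2
      rw [Set.eq_univ_iff_forall]
      intro a
      fin_cases a
      · exact Or.inl ⟨i, e1⟩
      · exact Or.inr rfl
      · exact Or.inl ⟨j, e2⟩
      · exact Or.inl ⟨k, e3⟩⟩
  naturality _ _ _ := rfl

lemma not_qc : ¬ SSet.Quasicategory XX.{u} := by
  intro h
  obtain ⟨s, hs⟩ := h.hornFilling (n := 3) (i := 1) (by decide) (by decide) hornMap.{u}
  let x : XX.{u} _⦋3⦌ := s.app _ (SSet.stdSimplex.objEquiv.symm (𝟙 ⦋3⦌))
  have key : ∀ (a b c : Fin 4) (hab : a ≤ b), c ≠ 1 → c ≠ a → c ≠ b → x.1 a b = w a b := by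
    intro a b c hab h1 h2 h3
    let f : (⦋1⦌ : SimplexCategory) ⟶ ⦋3⦌ := SimplexCategory.mkHom
      ⟨![a, b], by intro i j hij; fin_cases i <;> fin_cases j <;> simp_all⟩
    let g : (Λ[3, 1] : SSet.{u}) _⦋1⦌ := ⟨SSet.stdSimplex.objEquiv.symm f, by
      rw [SSet.mem_horn_iff, Ne, Set.eq_univ_iff_forall]
      intro h
      rcases h c with ⟨i, hi⟩ | h
      · change ![a, b] i = c at hi
        fin_cases i
        · exact h2 hi.symm
        · exact h3 hi.symm
      · exact h1 h⟩
    have e1 : s.app _ g.1 = XX.map f.op x := by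
      have := NatTrans.naturality_apply s f.op (SSet.stdSimplex.objEquiv.symm (𝟙 ⦋3⦌))
      rw [← this]
      congr 1
    have e2 : hornMap.app _ g = s.app _ g.1 := by rw [hs]; rfl
    have e3 := congrArg (fun z => z.1 0 1) (e2.trans e1)
    exact e3.symm
  apply x.2.2 0 2 3
  · rw [key 0 2 3 (by decide) (by decide) (by decide) (by decide)]; rfl
  · rw [key 2 3 0 (by decide) (by decide) (by decide) (by decide)]; rfl
  · rw [key 0 3 2 (by decide) (by decide) (by decide) (by decide)]; rfl

end NaFEx

/-- There exists a simplicial set admitting a (strongly unital) nonassociative Frobenius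
structure which is not a quasi-category; hence the converse of "every quasi-category
admits a nonassociative Frobenius structure" fails. -/
theorem exists_naF_not_quasicategory :
    ∃ X : SSet, Nonempty (NaF.Struct X) ∧ ¬ SSet.Quasicategory X := ⟨NaFEx.XX, ⟨NaFEx.str⟩, NaFEx.not_qc⟩
end

section
/- There exists a simplicial set X which lifts wedges — i.e. for every n ≥ 2 and all y, z ∈ X_{n−1} with d_0(y) = d_{n−1}(z) there exists w ∈ X_n with d_n(w) = y and d_0(w) = z — but which is not a quasi-category. -/
open CategoryTheory Simplicial SSet

/-- A simplicial set `X` lifts wedges if for every `n = m + 2 ≥ 2` and all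
`(n-1)`-simplices `y, z` with `d_0 y = d_{n-1} z` there exists an `n`-simplex `w`
with `d_n w = y` and `d_0 w = z`. -/
def LiftsWedges (X : SSet) : Prop :=
  ∀ (m : ℕ) (y z : X _⦋m + 1⦌), X.δ 0 y = X.δ (Fin.last (m + 1)) z →
    ∃ w : X _⦋m + 2⦌, X.δ (Fin.last (m + 2)) w = y ∧ X.δ 0 w = z

universe u

/-- Up-closed irreflexive families of intervals. -/
structure IntRel (α : Type) [Preorder α] where
  r : α → α → Prop
  mono : ∀ {i i' j j'}, i' ≤ i → j ≤ j' → r i j → r i' j'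
  irr : ∀ i, ¬ r i i

theorem IntRel.ext' {α : Type} [Preorder α] {x y : IntRel α} (h : ∀ i j, x.r i j ↔ y.r i j) :
    x = y := by
  cases x; cases y
  have : ∀ {a b : α → α → Prop}, (∀ i j, a i j ↔ b i j) → a = b := fun h => by
    funext i j; exact propext (h i j)
  have := this h
  subst this
  rfl

/-- Pull back. -/
def IntRel.comap {α β : Type} [Preorder α] [Preorder β] (x : IntRel β) (f : α →o β) :
    IntRel α where
  r i j := x.r (f i) (f j)
  mono h h' := x.mono (f.monotone h) (f.monotone h')
  irr i := x.irr _

/-- The counterexample. -/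
def cex : SSet.{u} where
  obj n := ULift.{u} (IntRel (Fin (n.unop.len + 1)))
  map f := TypeCat.ofHom fun x => ⟨x.down.comap f.unop.toOrderHom⟩
  map_id _ := rfl
  map_comp _ _ := rfl

theorem cex_map {n m : SimplexCategoryᵒᵖ} (f : n ⟶ m) (x : cex.{u}.obj n) (i j) :
    (cex.{u}.map f x).down.r i j ↔ x.down.r (f.unop.toOrderHom i) (f.unop.toOrderHom j) := Iff.rfl

theorem cex_δ {n : ℕ} (k : Fin (n + 2)) (x : cex.{u} _⦋n + 1⦌) (i j : Fin (n + 1)) :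
    (cex.{u}.δ k x).down.r i j ↔ x.down.r (k.succAbove i) (k.succAbove j) := Iff.rfl

theorem IntRel.lt {n : ℕ} (x : IntRel (Fin n)) {i j} (h : x.r i j) : i < j := by
  by_contra h'
  exact x.irr i (x.mono le_rfl (not_lt.1 h') h)

/-- Wedge filler. -/
def filler {m : ℕ} (y z : IntRel (Fin (m + 2))) : IntRel (Fin (m + 3)) where
  r i j := (i = 0 ∧ j = Fin.last _) ∨ (∃ a b, y.r a b ∧ i ≤ Fin.castSucc a ∧ Fin.castSucc b ≤ j) ∨
    (∃ a b, z.r a b ∧ i ≤ Fin.succ a ∧ Fin.succ b ≤ j)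
  mono := by
    rintro i i' j j' hi hj (⟨rfl, rfl⟩ | ⟨a, b, h, h1, h2⟩ | ⟨a, b, h, h1, h2⟩)
    · exact Or.inl ⟨Fin.le_zero_iff.1 hi, Fin.last_le_iff.1 hj⟩
    · exact Or.inr (Or.inl ⟨a, b, h, hi.trans h1, h2.trans hj⟩)
    · exact Or.inr (Or.inr ⟨a, b, h, hi.trans h1, h2.trans hj⟩)
  irr := by
    rintro i (⟨rfl, h⟩ | ⟨a, b, h, h1, h2⟩ | ⟨a, b, h, h1, h2⟩)
    · simp [Fin.ext_iff] at h
    · have := y.lt h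
      have := h2.trans h1
      simp only [Fin.le_def, Fin.lt_def, Fin.val_castSucc] at *
      omega
    · have := z.lt h
      have := h2.trans h1
      simp only [Fin.le_def, Fin.lt_def, Fin.val_succ] at *
      omega

theorem cex_lifts : LiftsWedges cex.{u} := by
  intro m y z hyz
  have key : ∀ i j : Fin (m + 1), y.down.r i.succ j.succ ↔ z.down.r i.castSucc j.castSucc := by
    intro i j
    have := cex_δ (Fin.last _) z i j
    rw [← hyz, cex_δ] at this
    simpa using this
  refine ⟨⟨filler y.down z.down⟩, ?_, ?_⟩
  · apply ULift.ext
    apply IntRel.ext'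
    intro (i : Fin (m + 2)) (j : Fin (m + 2))
    refine (cex_δ _ _ i j).trans ?_
    simp only [Fin.succAbove_last]
    constructor
    · rintro (⟨-, h⟩ | ⟨a, b, h, h1, h2⟩ | ⟨a, b, h, h1, h2⟩)
      · exact absurd h (Fin.castSucc_ne_last _)
      · exact y.down.mono (by simpa using h1) (by simpa using h2) h
      · have hab := z.down.lt h
        simp only [Fin.le_def, Fin.lt_def, Fin.val_succ, Fin.val_castSucc] at *
        obtain ⟨a, rfl⟩ : ∃ a' : Fin (m + 1), a = a'.castSucc := ⟨⟨a, by omega⟩, rfl⟩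
        obtain ⟨b, rfl⟩ : ∃ a' : Fin (m + 1), b = a'.castSucc := ⟨⟨b, by omega⟩, rfl⟩
        rw [← key] at h
        exact y.down.mono (by simpa [Fin.le_def] using h1) (by simpa [Fin.le_def] using h2) h
    · intro h
      exact Or.inr (Or.inl ⟨i, j, h, le_rfl, le_rfl⟩)
  · apply ULift.ext
    apply IntRel.ext'
    intro (i : Fin (m + 2)) (j : Fin (m + 2))
    refine (cex_δ _ _ i j).trans ?_
    simp only [Fin.zero_succAbove]
    constructor
    · rintro (⟨h, -⟩ | ⟨a, b, h, h1, h2⟩ | ⟨a, b, h, h1, h2⟩)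
      · exact absurd h (Fin.succ_ne_zero _)
      · have hab := y.down.lt h
        simp only [Fin.le_def, Fin.lt_def, Fin.val_succ, Fin.val_castSucc] at *
        obtain ⟨a, rfl⟩ : ∃ a' : Fin (m + 1), a = a'.succ :=
          ⟨⟨a - 1, by omega⟩, Fin.ext (by simp; omega)⟩
        obtain ⟨b, rfl⟩ : ∃ a' : Fin (m + 1), b = a'.succ :=
          ⟨⟨b - 1, by omega⟩, Fin.ext (by simp; omega)⟩
        rw [key] at h
        exact z.down.mono (by simpa [Fin.le_def] using h1) (by simpa [Fin.le_def] using h2) h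
      · exact z.down.mono (by simpa using h1) (by simpa using h2) h
    · intro h
      exact Or.inr (Or.inr ⟨i, j, h, le_rfl, le_rfl⟩)

/-- The relation on a simplex of the horn. -/
def hornRel {α : Type} [Preorder α] (s : α →o Fin 4)
    (h : Set.range s ∪ {1} ≠ Set.univ) : IntRel α where
  r i j := s i = 0 ∧ s j = 2
  mono := by
    rintro i i' j j' hi hj ⟨h1, h2⟩
    have h3 := s.monotone hi
    have h4 := s.monotone hj
    refine ⟨Fin.le_zero_iff.1 (h1 ▸ h3), ?_⟩
    by_contra h5
    apply h
    rw [h2] at h4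
    have h6 : s j' = 3 := by
      generalize s j' = t at *
      fin_cases t <;> simp_all
    ext t
    simp only [Set.mem_union, Set.mem_range, Set.mem_singleton_iff, Set.mem_univ, iff_true]
    fin_cases t
    · exact Or.inl ⟨i, h1⟩
    · exact Or.inr rfl
    · exact Or.inl ⟨j, h2⟩
    · exact Or.inl ⟨j', h6⟩
  irr := by
    rintro i ⟨h1, h2⟩
    rw [h1] at h2
    simp at h2

/-- The horn without filler. -/
def hornMap : (Λ[3, 1] : SSet.{u}) ⟶ cex.{u} where
  app n := TypeCat.ofHom fun s => ⟨hornRel (stdSimplex.asOrderHom s.1) s.2⟩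
  naturality _ _ _ := rfl

/-- There exists a simplicial set which lifts wedges but is not a quasi-category. -/
theorem exists_liftsWedges_not_quasicategory :
    ∃ X : SSet, LiftsWedges X ∧ ¬ SSet.Quasicategory X := by
  refine ⟨cex, cex_lifts, fun hq => ?_⟩
  obtain ⟨σ, hσ⟩ := hq.hornFilling (n := 3) (i := 1) (by decide) (by decide) hornMap
  let x : cex _⦋3⦌ := σ.app _ (stdSimplex.objEquiv.symm (𝟙 ⦋3⦌))
  have hx : ∀ (f : ⦋1⦌ ⟶ ⦋3⦌) (i j : Fin 2), x.down.r (f.toOrderHom i) (f.toOrderHom j) ↔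
      f.toOrderHom i = 0 ∧ f.toOrderHom j = 2 := by
    intro f i j
    have hmem : stdSimplex.objEquiv.symm f ∈ (Λ[3, 1] : (Δ[3] : SSet).Subcomplex).obj (.op ⦋1⦌) := by
      rw [horn_obj_eq_univ 1 1]; trivial
    have h1 : σ.app (.op ⦋1⦌) (stdSimplex.objEquiv.symm f) = cex.map f.op x := by
      have h0 := NatTrans.naturality_apply σ f.op (stdSimplex.objEquiv.symm (𝟙 ⦋3⦌))
      rw [stdSimplex.map_objEquiv_symm] at h0
      rw [Category.comp_id] at h0
      exact h0
    have h2 : hornMap.app (.op ⦋1⦌) ⟨_, hmem⟩ = σ.app (.op ⦋1⦌) (stdSimplex.objEquiv.symm f) := by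
      rw [hσ]; rfl
    have h3 := cex_map f.op x i j
    rw [← h1, ← h2] at h3
    exact h3.symm
  have h02 := hx (SimplexCategory.Hom.mk ⟨![0, 2], by decide⟩) 0 1
  have h03 := hx (SimplexCategory.Hom.mk ⟨![0, 3], by decide⟩) 0 1
  have a02 : x.down.r 0 2 := h02.2 ⟨rfl, rfl⟩
  have a03 : x.down.r 0 3 := x.down.mono le_rfl (by decide) a02
  have := (h03.1 a03).2
  exact absurd this (by decide)
end

section
/- Let C be a category and Ψ : C ⥤ Cat a functor such that: (1) C is cocomplete; (2) the category Ψ(c) is cocomplete for every object c of C; and (3) the functor Ψ(f) preserves colimits for every morphism f of C. Then the Grothendieck construction ∫Ψ is cocomplete, and the projection functor ∫Ψ → C preserves colimits. -/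
open CategoryTheory CategoryTheory.Limits

universe v u

namespace GrothColim

variable {C : Type u} [Category.{v} C] {Ψ : C ⥤ Cat.{v, u}}

lemma eqToHom_two {D : Type*} [Category D] {a b c d : D} (h1 : a = b) (h2 : b = c) (h3 : a = c)
    (f : c ⟶ d) : eqToHom h1 ≫ eqToHom h2 ≫ f = eqToHom h3 ≫ f := by
  subst h1 h2; simp

lemma eqToHom_cancel' {D : Type*} [Category D] {a b d d' : D} (h1 : a = b) (h2 : b = a)
    (f : a ⟶ d) (g : d ⟶ d') : eqToHom h1 ≫ (eqToHom h2 ≫ f) ≫ g = f ≫ g := by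
  subst h1; simp

lemma eqToHom_cancel {D : Type*} [Category D] {a b d : D} (h1 : a = b) (h2 : b = a)
    (f : a ⟶ d) : eqToHom h1 ≫ eqToHom h2 ≫ f = f := by
  subst h1; simp

/-- Equal base morphisms act equally on fibre morphisms. -/
lemma map_congr {a b : C} {f g : a ⟶ b} (h : f = g) {x y : Ψ.obj a} (φ : x ⟶ y) :
    (Ψ.map f).toFunctor.map φ =
      eqToHom (by rw [h]) ≫ (Ψ.map g).toFunctor.map φ ≫ eqToHom (by rw [h]) := by
  subst h; simp

/-- Composite base morphisms act by composition. -/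
lemma map_comp' {a b c : C} (f : a ⟶ b) (g : b ⟶ c) {x y : Ψ.obj a} (φ : x ⟶ y) :
    (Ψ.map (f ≫ g)).toFunctor.map φ =
      eqToHom (by simp) ≫ (Ψ.map g).toFunctor.map ((Ψ.map f).toFunctor.map φ) ≫
        eqToHom (by simp) :=
  Functor.congr_hom congr($(Ψ.map_comp f g).toFunctor) φ

lemma map_id' {a : C} {x y : Ψ.obj a} (φ : x ⟶ y) :
    (Ψ.map (𝟙 a)).toFunctor.map φ = eqToHom (by simp) ≫ φ ≫ eqToHom (by simp) :=
  Functor.congr_hom congr($(Ψ.map_id a).toFunctor) φ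

/-- Combined congruence and composition. -/
lemma map_comp_of_eq {a b c : C} {f : a ⟶ b} {g : b ⟶ c} {h : a ⟶ c} (w : f ≫ g = h)
    {x y : Ψ.obj a} (φ : x ⟶ y) :
    (Ψ.map h).toFunctor.map φ =
      eqToHom (by subst w; simp) ≫ (Ψ.map g).toFunctor.map ((Ψ.map f).toFunctor.map φ) ≫
        eqToHom (by subst w; simp) := by
  subst w; exact map_comp' f g φ

lemma obj_of_eq {a b c : C} {f : a ⟶ b} {g : b ⟶ c} {h : a ⟶ c} (w : f ≫ g = h)
    (x : Ψ.obj a) :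
    (Ψ.map h).toFunctor.obj x = (Ψ.map g).toFunctor.obj ((Ψ.map f).toFunctor.obj x) := by
  subst w; simp

/-- Composition in the Grothendieck construction, on the fibre. -/
lemma fiber_of_comp_eq {X Y Z : Grothendieck Ψ} {f : X ⟶ Y} {g : Y ⟶ Z} {h : X ⟶ Z}
    (w : f ≫ g = h) :
    (Ψ.map g.base).toFunctor.map f.fiber ≫ g.fiber =
      eqToHom (by subst w; simp) ≫ h.fiber := by
  subst w
  exact (eqToHom_cancel _ _ _).symm

lemma hom_ext' {X Y Z : Grothendieck Ψ} {f : X ⟶ Y} {g : Y ⟶ Z} {h : X ⟶ Z}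
    (w : f.base ≫ g.base = h.base)
    (w' : (Ψ.map g.base).toFunctor.map f.fiber ≫ g.fiber =
      eqToHom (obj_of_eq w _).symm ≫ h.fiber) : f ≫ g = h := by
  refine Grothendieck.ext _ _ w ?_
  rw [Grothendieck.comp_fiber, w']
  exact (eqToHom_two _ _ (by rw [← obj_of_eq w]) _).trans (eqToHom_cancel _ _ _)

variable {J : Type v} [Category.{v} J] (G : J ⥤ Grothendieck Ψ)
  {p : C} (k : ∀ j, (G.obj j).base ⟶ p)
  (hk : ∀ {i j : J} (f : i ⟶ j), (G.map f).base ≫ k j = k i)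

/-- The diagram pushed forward to the fibre over the cocone point. -/
def pushed : J ⥤ Ψ.obj p where
  obj j := (Ψ.map (k j)).toFunctor.obj (G.obj j).fiber
  map {i j} f := eqToHom (obj_of_eq (hk f) _) ≫ (Ψ.map (k j)).toFunctor.map (G.map f).fiber
  map_id j := by
    rw [Grothendieck.congr (G.map_id j), Grothendieck.id_fiber, eqToHom_trans, eqToHom_map,
      eqToHom_trans, eqToHom_refl]
  map_comp {i j l} f g := by
    rw [Grothendieck.congr (G.map_comp f g), map_comp_of_eq (hk g), Grothendieck.comp_fiber]
    simp only [Functor.map_comp, Category.assoc, eqToHom_trans_assoc, eqToHom_refl,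
      Category.id_comp]
    erw [eqToHom_map]
    exact eqToHom_two _ _ _ _

/-- Maps to the base point and the pushed diagram give a cocone over `G`. -/
def totalCocone (q : Ψ.obj p) (e : ∀ j, (pushed G k hk).obj j ⟶ q)
    (he : ∀ {i j : J} (f : i ⟶ j), (pushed G k hk).map f ≫ e j = e i) : Cocone G where
  pt := ⟨p, q⟩
  ι :=
    { app := fun j => ⟨k j, e j⟩
      naturality := fun i j f => by
        refine Eq.trans ?_ (Category.comp_id _).symm
        refine hom_ext' (hk f) ?_
        have h2 := he f
        change (eqToHom (obj_of_eq (hk f) _) ≫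
          (Ψ.map (k j)).toFunctor.map (G.map f).fiber) ≫ e j = e i at h2
        change (Ψ.map (k j)).toFunctor.map (G.map f).fiber ≫ e j = eqToHom _ ≫ e i
        rw [← h2]
        exact (eqToHom_cancel' _ _ _ _).symm }

/-- The cocone on the fibre of the target. -/
def fiberCocone {Z : Grothendieck Ψ} (s : ∀ j, G.obj j ⟶ Z)
    (hs : ∀ {i j : J} (f : i ⟶ j), G.map f ≫ s j = s i) (b : p ⟶ Z.base)
    (hb : ∀ j, k j ≫ b = (s j).base) :
    Cocone (pushed G k hk ⋙ (Ψ.map b).toFunctor) where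
  pt := Z.fiber
  ι :=
    { app := fun j => eqToHom (obj_of_eq (hb j) _).symm ≫ (s j).fiber
      naturality := fun i j f => by
        have h := fiber_of_comp_eq (hs f)
        rw [map_comp_of_eq (hb j)] at h
        refine Eq.trans ?_ (Category.comp_id _).symm
        change (Ψ.map b).toFunctor.map (eqToHom (obj_of_eq (hk f) _) ≫
          (Ψ.map (k j)).toFunctor.map (G.map f).fiber) ≫ eqToHom _ ≫ (s j).fiber =
            eqToHom _ ≫ (s i).fiber
        simp only [Category.assoc, eqToHom_comp_iff, Functor.map_comp, eqToHom_map,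
          eqToHom_trans_assoc] at h ⊢
        rw [h] }

variable [∀ {c d : C} (f : c ⟶ d), PreservesColimits (Ψ.map f).toFunctor]

/-- The total cocone is a colimit. -/
lemma total_isColimit
    (b : ∀ {z : C} (s : ∀ j, (G.obj j).base ⟶ z)
      (_ : ∀ {i j : J} (f : i ⟶ j), (G.map f).base ≫ s j = s i), ∃ b : p ⟶ z, ∀ j, k j ≫ b = s j)
    (hext : ∀ {z : C} (b b' : p ⟶ z), (∀ j, k j ≫ b = k j ≫ b') → b = b')
    {e : Cocone (pushed G k hk)} (he : IsColimit e) :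
    Nonempty (IsColimit (totalCocone G k hk e.pt (fun j => e.ι.app j) (fun f => e.w f))) := by
  have hP : ∀ {z : C} (b : p ⟶ z), PreservesColimit (pushed G k hk) (Ψ.map b).toFunctor :=
    fun b => inferInstance
  refine ⟨IsColimit.ofExistsUnique fun s => ?_⟩
  obtain ⟨h, hh⟩ := b (z := s.pt.base) (fun j => (s.ι.app j).base)
    (fun {i j} f => congrArg Grothendieck.Hom.base (s.w f))
  have hl := isColimitOfPreserves (Ψ.map h).toFunctor he
  let F := fiberCocone G k hk (Z := s.pt) (fun j => s.ι.app j) (fun f => s.w f) h hh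
  refine ⟨⟨h, hl.desc F⟩, fun j => hom_ext' (hh j) (hl.fac F j), ?_⟩
  rintro ⟨h', φ⟩ hm
  obtain rfl : h' = h := hext _ _ fun j =>
    (congrArg Grothendieck.Hom.base (hm j)).trans (hh j).symm
  congr 1
  exact hl.uniq F φ fun j => fiber_of_comp_eq (hm j)

end GrothColim

/-- If `C` is cocomplete, each fiber `Ψ.obj c` is cocomplete, and each transition functor
`Ψ.map f` preserves colimits, then the Grothendieck construction `∫Ψ` is cocomplete and
the projection `∫Ψ ⥤ C` preserves colimits. -/
theorem grothendieck_cocomplete_and_forget_preservesColimits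
    {C : Type u} [Category.{v} C] (Ψ : C ⥤ Cat.{v, u})
    [HasColimits C]
    [∀ c : C, HasColimits (Ψ.obj c)]
    [∀ {c d : C} (f : c ⟶ d), PreservesColimits (Ψ.map f).toFunctor] :
    HasColimits (Grothendieck Ψ) ∧
      Nonempty (PreservesColimits (Grothendieck.forget Ψ)) := by
  have key : ∀ (J : Type v) [Category.{v} J] (G : J ⥤ Grothendieck Ψ),
      HasColimit G ∧ PreservesColimit G (Grothendieck.forget Ψ) := by
    intro J _ G
    let c := colimit.cocone (G ⋙ Grothendieck.forget Ψ)
    have hc : IsColimit c := colimit.isColimit _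
    let k : ∀ j, (G.obj j).base ⟶ c.pt := fun j => c.ι.app j
    have hk : ∀ {i j : J} (f : i ⟶ j), (G.map f).base ≫ k j = k i := fun f => c.w f
    obtain ⟨hT⟩ := GrothColim.total_isColimit G k hk
      (fun {z} s hs => ⟨hc.desc ⟨z, ⟨fun j => s j, fun i j f =>
        (hs f).trans (Category.comp_id _).symm⟩⟩, fun j => hc.fac _ j⟩)
      (fun b b' h => hc.hom_ext h)
      (colimit.isColimit (GrothColim.pushed G k hk))
    exact ⟨⟨⟨⟨_, hT⟩⟩⟩, preservesColimit_of_preserves_colimit_cocone hT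
      (IsColimit.ofIsoColimit hc (Cocone.ext (Iso.refl _) (fun j => Category.comp_id _)))⟩
  exact ⟨⟨fun J _ => ⟨fun G => (key J G).1⟩⟩, ⟨⟨fun {J} _ => ⟨fun {G} => (key J G).2⟩⟩⟩⟩
end
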